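/- arXiv:1010.4189 — 4 statements merged into one kernel-verified Lean document; each statement's English description precedes it below -/
import Mathlib

section
/- Let q > 0, let M be the 2×2 complex matrix with rows (1, q) and (0, −1), and set b = q/2 and a = √(1+b²). Let μ be the uniform probability measure on the unit sphere Ω₂ of ℂ². Then for every r with 0 ≤ r ≤ 1, the μ-measure of the set of unit vectors u ∈ Ω₂ such that (Re⟨Mu,u⟩)²/a² + (Im⟨Mu,u⟩)²/b² ≤ r² equals 1 − √(1 − r²). (In particular, the numerical shadow of M assigns mass 1 − √(1−r²) to the scaled ellipse rE, where E is the filled ellipse with horizontal semiaxis a and vertical semiaxis b centered at 0.) -/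
open MeasureTheory Matrix

/-- The quadratic form `⟨Au,u⟩ = u*Au = ∑_{i,j} conj(u_i) A_{ij} u_j`. -/
noncomputable def qf {ι : Type*} [Fintype ι] (A : Matrix ι ι ℂ) (u : EuclideanSpace ℂ ι) : ℂ :=
  ∑ i, ∑ j, (starRingEnd ℂ) (u i) * A i j * u j

/-- `μ` is the uniform probability measure on the unit sphere `Ω = {u : ‖u‖ = 1}` of `ℂ^ι`:
a Borel probability measure concentrated on the sphere and invariant under the unitary group. -/
def IsUniformOnSphere {ι : Type*} [Fintype ι] [DecidableEq ι]
    [MeasurableSpace (EuclideanSpace ℂ ι)] [BorelSpace (EuclideanSpace ℂ ι)]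
    (μ : Measure (EuclideanSpace ℂ ι)) : Prop :=
  IsProbabilityMeasure μ ∧ μ (Metric.sphere 0 1) = 1 ∧
    ∀ U ∈ Matrix.unitaryGroup ι ℂ, μ.map (fun u => Matrix.toEuclideanLin U u) = μ

/-- The linear map of `ℂ²` whose first coordinate is the inner product with `(a, b)`; it is unitary
when `(a, b)` is a unit vector. -/
noncomputable def rot (a b : ℂ) (p : ℂ × ℂ) : ℂ × ℂ :=
  (star a * p.1 + star b * p.2, -b * p.1 + a * p.2)

/-- The squared Euclidean norm on `ℂ²`. -/
noncomputable def nsq (p : ℂ × ℂ) : ℝ := ‖p.1‖ ^ 2 + ‖p.2‖ ^ 2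

lemma continuous_rot (a b : ℂ) : Continuous (rot a b) := by unfold rot; fun_prop

lemma continuous_nsq : Continuous nsq := by unfold nsq; fun_prop

lemma nsq_pos {p : ℂ × ℂ} (hp : p ≠ 0) : 0 < nsq p := by
  have : p.1 ≠ 0 ∨ p.2 ≠ 0 := by
    by_contra! h
    exact hp (Prod.ext h.1 h.2)
  unfold nsq
  rcases this with h | h
  · have := norm_pos_iff.2 h
    positivity
  · have := norm_pos_iff.2 h
    positivity

lemma nsq_rot (a b : ℂ) (p : ℂ × ℂ) : nsq (rot a b p) = nsq (a, b) * nsq p := by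
  simp only [nsq, rot, Complex.sq_norm, Complex.normSq_apply, Complex.star_def, Complex.add_re,
    Complex.add_im, Complex.mul_re, Complex.mul_im, Complex.conj_re, Complex.conj_im,
    Complex.neg_re, Complex.neg_im]
  ring

/-- Invariance of a measure on `ℂ²` under all the unitary maps `rot a b`. -/
def RotInvariant (ν : Measure (ℂ × ℂ)) : Prop :=
  ∀ a b : ℂ, nsq (a, b) = 1 → MeasurePreserving (rot a b) ν ν

lemma RotInvariant.measure_inner_le {ν : Measure (ℂ × ℂ)} (hν : RotInvariant ν) (s : ℝ)
    {w : ℂ × ℂ} (hw : w ≠ 0) :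
    ν {p | ‖star w.1 * p.1 + star w.2 * p.2‖ ^ 2 ≤ s * (nsq w * nsq p)} =
      ν {p | ‖p.1‖ ^ 2 ≤ s * nsq p} := by
  have hn : 0 < nsq w := nsq_pos hw
  set c : ℝ := (√(nsq w))⁻¹ with hc
  have hc2 : c ^ 2 * nsq w = 1 := by
    rw [hc, inv_pow, Real.sq_sqrt hn.le, inv_mul_cancel₀ hn.ne']
  have hunit : nsq ((c : ℂ) * w.1, (c : ℂ) * w.2) = 1 := by
    rw [← hc2]
    simp only [nsq, norm_mul, mul_pow, Complex.norm_real, Real.norm_eq_abs, sq_abs]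
    ring
  have hm : MeasurableSet {p : ℂ × ℂ | ‖p.1‖ ^ 2 ≤ s * nsq p} :=
    measurableSet_le (by fun_prop) (continuous_nsq.measurable.const_mul s)
  rw [← (hν _ _ hunit).measure_preimage hm.nullMeasurableSet]
  congr 1
  ext p
  have hfst : ‖(rot ((c : ℂ) * w.1) ((c : ℂ) * w.2) p).1‖ ^ 2 =
      c ^ 2 * ‖star w.1 * p.1 + star w.2 * p.2‖ ^ 2 := by
    have : (rot ((c : ℂ) * w.1) ((c : ℂ) * w.2) p).1 =
        (c : ℂ) * (star w.1 * p.1 + star w.2 * p.2) := by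
      simp [rot]
      ring
    rw [this, norm_mul, mul_pow, Complex.norm_real, Real.norm_eq_abs, sq_abs]
  have hc0 : 0 < c ^ 2 := by positivity
  simp only [Set.mem_ofPred_eq, Set.mem_preimage, hfst, nsq_rot, hunit, one_mul]
  rw [← mul_le_mul_iff_right₀ hc0, show c ^ 2 * (s * (nsq w * nsq p)) =
    s * ((c ^ 2 * nsq w) * nsq p) by ring, hc2, one_mul]

lemma measurePreserving_rot {a b : ℂ} (hab : nsq (a, b) = 1) :
    MeasurePreserving (rot a b) volume volume := by
  let L : WithLp 2 (ℂ × ℂ) →ₗᵢ[ℝ] WithLp 2 (ℂ × ℂ) :=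
    { toFun := fun p => WithLp.toLp 2 (rot a b p.ofLp)
      map_add' := fun x y => by
        refine WithLp.ofLp_injective 2 (Prod.ext ?_ ?_) <;> simp [rot] <;> ring
      map_smul' := fun r x => by
        refine WithLp.ofLp_injective 2 (Prod.ext ?_ ?_) <;> simp [rot] <;> ring
      norm_map' := fun p => by
        have h := nsq_rot a b p.ofLp
        rw [hab, one_mul] at h
        simp only [nsq] at h
        simp only [LinearMap.coe_mk, AddHom.coe_mk, WithLp.prod_norm_eq_of_L2]
        exact congrArg Real.sqrt h }
  have hL := (L.toLinearIsometryEquiv rfl).measurePreserving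
  exact ((WithLp.volume_preserving_ofLp ℂ ℂ).comp hL).comp (WithLp.volume_preserving_toLp ℂ ℂ)

/-- The measure on `ℂ` with density `exp (-‖z‖²)`. -/
noncomputable def gauss : Measure ℂ :=
  volume.withDensity fun z => ENNReal.ofReal (Real.exp (-‖z‖ ^ 2))

lemma lintegral_exp_neg_mul_sq {c : ℝ} (hc : 0 < c) :
    ∫⁻ z : ℂ, ENNReal.ofReal (Real.exp (-c * ‖z‖ ^ 2)) = ENNReal.ofReal (Real.pi / c) := by
  have h := GaussianFourier.integral_rexp_neg_mul_sq_norm (V := ℂ) hc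
  have hp : 0 < Real.pi / c := by positivity
  rw [← ofReal_integral_eq_lintegral_ofReal]
  · rw [h]; simp
  · by_contra hi
    rw [integral_undef hi] at h
    simp at h
    exact absurd h (by positivity)
  · exact Filter.Eventually.of_forall fun z => (Real.exp_pos _).le

lemma gauss_univ : gauss Set.univ = ENNReal.ofReal Real.pi := by
  rw [gauss, withDensity_apply _ MeasurableSet.univ, Measure.restrict_univ]
  simpa using lintegral_exp_neg_mul_sq one_pos

instance : IsFiniteMeasure gauss := ⟨by rw [gauss_univ]; exact ENNReal.ofReal_lt_top⟩

lemma gauss_lt_norm_sq {k : ℝ} (hk : 0 ≤ k) :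
    gauss {z | k < ‖z‖ ^ 2} = ENNReal.ofReal (Real.pi * Real.exp (-k)) := by
  have hm : MeasurableSet {z : ℂ | k < ‖z‖ ^ 2} := measurableSet_lt (by fun_prop) (by fun_prop)
  have hint : Integrable (fun z : ℂ => Real.exp (-‖z‖ ^ 2)) := by
    by_contra hi
    have h := GaussianFourier.integral_rexp_neg_mul_sq_norm (V := ℂ) one_pos
    simp only [neg_mul, one_mul] at h
    rw [integral_undef hi] at h
    simp [Real.pi_ne_zero.symm] at h
  rw [gauss, withDensity_apply _ hm, ← ofReal_integral_eq_lintegral_ofReal hint.integrableOn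
    (Filter.Eventually.of_forall fun z => (Real.exp_pos _).le), ← integral_indicator hm]
  congr 1
  have h := integral_fun_norm_addHaar (volume : Measure ℂ)
    ((Set.Ioi √k).indicator fun y : ℝ => Real.exp (-y ^ 2))
  have hd : ∫ y in Set.Ioi √k, y * Real.exp (-y ^ 2) = Real.exp (-k) / 2 := by
    have hder : ∀ x ∈ Set.Ici √k, HasDerivAt (fun y : ℝ => -(Real.exp (-y ^ 2) / 2))
        (x * Real.exp (-x ^ 2)) x := fun x _ => by
      have := ((((hasDerivAt_id x).pow 2).neg.exp).div_const 2).neg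
      convert! this using 1
      simp
      ring
    have ht : Filter.Tendsto (fun y : ℝ => -(Real.exp (-y ^ 2) / 2)) Filter.atTop (nhds 0) := by
      have : Filter.Tendsto (fun y : ℝ => Real.exp (-y ^ 2)) Filter.atTop (nhds 0) :=
        Real.tendsto_exp_neg_atTop_nhds_zero.comp (Filter.tendsto_pow_atTop two_ne_zero)
      simpa using (this.div_const 2).neg
    rw [integral_Ioi_of_hasDerivAt_of_nonneg' hder (fun x hx =>
      mul_nonneg ((Real.sqrt_nonneg k).trans (le_of_lt hx)) (Real.exp_pos _).le) ht,
      Real.sq_sqrt hk]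
    ring
  have hset : (fun z : ℂ => (Set.Ioi √k).indicator (fun y : ℝ => Real.exp (-y ^ 2)) ‖z‖) =
      {z : ℂ | k < ‖z‖ ^ 2}.indicator fun z => Real.exp (-‖z‖ ^ 2) := by
    ext z
    simp only [Set.indicator_apply, Set.mem_Ioi, Set.mem_ofPred_eq,
      Real.sqrt_lt hk (norm_nonneg z)]
  rw [← hset, h]
  simp only [Complex.finrank_real_complex, Nat.add_one_sub_one, pow_one, smul_eq_mul]
  have : ∀ y : ℝ, y * (Set.Ioi √k).indicator (fun y : ℝ => Real.exp (-y ^ 2)) y =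
      (Set.Ioi √k).indicator (fun y : ℝ => y * Real.exp (-y ^ 2)) y := fun y => by
    simp [Set.indicator_apply]
  simp only [this]
  rw [setIntegral_indicator measurableSet_Ioi, Set.Ioi_inter_Ioi,
    max_eq_right (Real.sqrt_nonneg k), hd, Measure.real, Complex.volume_ball]
  simp
  ring

lemma gauss_prod_univ : gauss.prod gauss Set.univ = ENNReal.ofReal (Real.pi ^ 2) := by
  rw [← Set.univ_prod_univ, Measure.prod_prod, gauss_univ, sq, ENNReal.ofReal_mul Real.pi_pos.le]

lemma gauss_prod_rotInvariant : RotInvariant (gauss.prod gauss) := by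
  intro a b hab
  have hρ : gauss.prod gauss = (volume : Measure (ℂ × ℂ)).withDensity
      fun p => ENNReal.ofReal (Real.exp (-nsq p)) := by
    rw [gauss, prod_withDensity (by fun_prop) (by fun_prop)]
    congr 1
    ext p
    rw [← ENNReal.ofReal_mul (Real.exp_pos _).le, ← Real.exp_add, nsq]
    congr 2
    ring
  have hv := measurePreserving_rot hab
  have hf : Measurable fun p => ENNReal.ofReal (Real.exp (-nsq p)) :=
    (Real.continuous_exp.comp continuous_nsq.neg).measurable.ennreal_ofReal
  refine ⟨hv.measurable, Measure.ext fun s hs => ?_⟩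
  rw [Measure.map_apply hv.measurable hs, hρ, withDensity_apply _ hs,
    withDensity_apply _ (hv.measurable hs), ← hv.setLIntegral_comp_preimage hs hf]
  simp [nsq_rot, hab]

lemma gauss_prod_norm_fst_sq_le {s : ℝ} (hs0 : 0 ≤ s) (hs1 : s < 1) :
    gauss.prod gauss {p | ‖p.1‖ ^ 2 ≤ s * nsq p} = ENNReal.ofReal (Real.pi ^ 2 * s) := by
  have hm : MeasurableSet {p : ℂ × ℂ | ‖p.1‖ ^ 2 ≤ s * nsq p} :=
    measurableSet_le (by fun_prop) (continuous_nsq.measurable.const_mul s)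
  have h1 : 0 < 1 - s := by linarith
  have hcompl : gauss.prod gauss {p | ‖p.1‖ ^ 2 ≤ s * nsq p}ᶜ =
      ENNReal.ofReal (Real.pi ^ 2 * (1 - s)) := by
    have hfib : ∀ y : ℂ, gauss ((fun x => (x, y)) ⁻¹' {p | ‖p.1‖ ^ 2 ≤ s * nsq p}ᶜ) =
        ENNReal.ofReal (Real.pi * Real.exp (-(s / (1 - s) * ‖y‖ ^ 2))) := fun y => by
      rw [← gauss_lt_norm_sq (by positivity)]
      congr 1
      ext x
      simp only [Set.mem_preimage, Set.mem_compl_iff, Set.mem_ofPred_eq, not_le, nsq]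
      rw [div_mul_eq_mul_div, div_lt_iff₀ h1]
      constructor <;> intro h <;> linarith
    rw [Measure.prod_apply_symm hm.compl]
    simp only [hfib]
    rw [gauss, lintegral_withDensity_eq_lintegral_mul _ (by fun_prop) (by fun_prop)]
    have hc : 0 < 1 / (1 - s) := by positivity
    have : ∀ y : ℂ, ENNReal.ofReal (Real.exp (-‖y‖ ^ 2)) *
        ENNReal.ofReal (Real.pi * Real.exp (-(s / (1 - s) * ‖y‖ ^ 2))) =
        ENNReal.ofReal Real.pi * ENNReal.ofReal (Real.exp (-(1 / (1 - s)) * ‖y‖ ^ 2)) := fun y => by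
      rw [← ENNReal.ofReal_mul (Real.exp_pos _).le,
        ← ENNReal.ofReal_mul Real.pi_pos.le, mul_left_comm, ← Real.exp_add]
      congr 3
      field_simp
      ring
    simp only [Pi.mul_apply, this]
    rw [lintegral_const_mul _ (by fun_prop), lintegral_exp_neg_mul_sq hc,
      ← ENNReal.ofReal_mul Real.pi_pos.le]
    congr 1
    field_simp
  rw [← compl_compl {p : ℂ × ℂ | ‖p.1‖ ^ 2 ≤ s * nsq p}, measure_compl hm.compl
    (measure_ne_top _ _), hcompl, gauss_prod_univ, ← ENNReal.ofReal_sub _ (by positivity)]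
  congr 1
  ring

lemma gauss_prod_zero : gauss.prod gauss {0} = 0 := by
  have : gauss {0} = 0 := withDensity_absolutelyContinuous _ _ (measure_singleton 0)
  rw [← Prod.mk_zero_zero, ← Set.singleton_prod_singleton, Measure.prod_prod, this, zero_mul]

/-- For a unitarily invariant probability measure on `ℂ²` without atom at the origin, the squared
modulus of the normalized first coordinate is uniformly distributed on `[0, 1]`. -/
lemma RotInvariant.measure_norm_fst_sq_le {ν : Measure (ℂ × ℂ)} [IsProbabilityMeasure ν]
    (hν : RotInvariant ν) (h0 : ν {0} = 0) {s : ℝ} (hs0 : 0 ≤ s) (hs1 : s < 1) :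
    ν {p | ‖p.1‖ ^ 2 ≤ s * nsq p} = ENNReal.ofReal s := by
  let A : Set ((ℂ × ℂ) × (ℂ × ℂ)) :=
    {x | ‖star x.1.1 * x.2.1 + star x.1.2 * x.2.2‖ ^ 2 ≤ s * (nsq x.1 * nsq x.2)}
  have hA : MeasurableSet A := by
    have := continuous_nsq
    exact (isClosed_le (by fun_prop) (by fun_prop)).measurableSet
  have hl := Measure.prod_apply (μ := ν) (ν := gauss.prod gauss) hA
  rw [Measure.prod_apply_symm hA] at hl
  have hne : ∀ {κ : Measure (ℂ × ℂ)}, κ {0} = 0 → ∀ᵐ p ∂κ, p ≠ 0 := fun h =>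
    measure_eq_zero_iff_ae_notMem.1 h
  have hr : ∀ᵐ p ∂ν, gauss.prod gauss (Prod.mk p ⁻¹' A) = ENNReal.ofReal (Real.pi ^ 2 * s) := by
    filter_upwards [hne h0] with p hp
    rw [← gauss_prod_norm_fst_sq_le hs0 hs1]
    exact gauss_prod_rotInvariant.measure_inner_le s hp
  have hL : ∀ᵐ q ∂gauss.prod gauss, ν ((fun p => (p, q)) ⁻¹' A) =
      ν {p | ‖p.1‖ ^ 2 ≤ s * nsq p} := by
    filter_upwards [hne gauss_prod_zero] with q hq
    rw [← hν.measure_inner_le s hq]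
    congr 1
    ext p
    simp only [A, Set.mem_preimage, Set.mem_ofPred_eq]
    rw [← norm_star, mul_comm (nsq p)]
    simp [mul_comm]
  rw [lintegral_congr_ae hr, lintegral_congr_ae hL, lintegral_const, lintegral_const,
    gauss_prod_univ, measure_univ, mul_one, mul_comm, ENNReal.ofReal_mul (by positivity)] at hl
  exact (ENNReal.mul_right_inj (by simp) ENNReal.ofReal_ne_top).1 hl

/-- The two coordinates of a vector of `ℂ²`. -/
def coords (u : EuclideanSpace ℂ (Fin 2)) : ℂ × ℂ := (u 0, u 1)

lemma continuous_coords : Continuous coords := by unfold coords; fun_prop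

lemma nsq_coords (u : EuclideanSpace ℂ (Fin 2)) : nsq (coords u) = ‖u‖ ^ 2 := by
  simp [nsq, coords, EuclideanSpace.norm_sq_eq]

lemma IsUniformOnSphere.rotInvariant_map_coords [MeasurableSpace (EuclideanSpace ℂ (Fin 2))]
    [BorelSpace (EuclideanSpace ℂ (Fin 2))] {μ : Measure (EuclideanSpace ℂ (Fin 2))}
    (hμ : IsUniformOnSphere μ) : RotInvariant (μ.map coords) := by
  intro a b hab
  have hr := (continuous_rot a b).measurable
  have hc := continuous_coords.measurable
  refine ⟨hr, ?_⟩
  have hab' : star a * a + star b * b = 1 := by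
    have h : ((nsq (a, b) : ℝ) : ℂ) = 1 := by rw [hab]; simp
    simpa [nsq, ← Complex.conj_mul'] using h
  have hU : !![star a, star b; -b, a] ∈ Matrix.unitaryGroup (Fin 2) ℂ := by
    rw [Matrix.mem_unitaryGroup_iff]
    ext i j
    fin_cases i <;> fin_cases j <;>
      simp [Matrix.mul_apply, Fin.sum_univ_two, Matrix.star_apply] <;>
      simp only [Complex.star_def] at hab' <;> first | linear_combination hab' | ring
  have hL : Measurable fun u => Matrix.toEuclideanLin !![star a, star b; -b, a] u :=
    (LinearMap.continuous_of_finiteDimensional _).measurable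
  have hcomm : rot a b ∘ coords =
      coords ∘ fun u => Matrix.toEuclideanLin !![star a, star b; -b, a] u := by
    ext u <;> simp [rot, coords, Matrix.toEuclideanLin, Matrix.mulVec, dotProduct,
      Fin.sum_univ_two]
  rw [Measure.map_map hr hc, hcomm, ← Measure.map_map hc hL, hμ.2.2 _ hU]

lemma IsUniformOnSphere.ae_norm_eq_one [MeasurableSpace (EuclideanSpace ℂ (Fin 2))]
    [BorelSpace (EuclideanSpace ℂ (Fin 2))] {μ : Measure (EuclideanSpace ℂ (Fin 2))}
    (hμ : IsUniformOnSphere μ) : ∀ᵐ u ∂μ, ‖u‖ = 1 := by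
  have := hμ.1
  have h := (mem_ae_iff_prob_eq_one (Metric.isClosed_sphere.measurableSet)).2 hμ.2.1
  filter_upwards [h] with u hu
  simpa using hu

/-- For a uniformly distributed unit vector `u` of `ℂ²` and a fixed unit vector `w`, the quantity
`|⟨w, u⟩|²` is uniformly distributed on `[0, 1]`. -/
lemma IsUniformOnSphere.measure_inner_le [MeasurableSpace (EuclideanSpace ℂ (Fin 2))]
    [BorelSpace (EuclideanSpace ℂ (Fin 2))] {μ : Measure (EuclideanSpace ℂ (Fin 2))}
    (hμ : IsUniformOnSphere μ) {w : ℂ × ℂ} (hw : nsq w = 1) {s : ℝ} (hs0 : 0 ≤ s) (hs1 : s < 1) :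
    μ {u | ‖star w.1 * u 0 + star w.2 * u 1‖ ^ 2 ≤ s} = ENNReal.ofReal s := by
  have := hμ.1
  have hc := continuous_coords.measurable
  have : IsProbabilityMeasure (μ.map coords) := Measure.isProbabilityMeasure_map hc.aemeasurable
  have h0 : μ.map coords {0} = 0 := by
    rw [Measure.map_apply hc (measurableSet_singleton 0), measure_eq_zero_iff_ae_notMem]
    filter_upwards [hμ.ae_norm_eq_one] with u hu h
    have h1 := nsq_coords u
    rw [show coords u = 0 from h, hu] at h1
    simp [nsq] at h1
  have hw0 : w ≠ 0 := by
    rintro rfl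
    simp [nsq] at hw
  have hν := hμ.rotInvariant_map_coords
  rw [← hν.measure_norm_fst_sq_le h0 hs0 hs1, ← hν.measure_inner_le s hw0,
    Measure.map_apply hc]
  · apply measure_congr
    filter_upwards [hμ.ae_norm_eq_one] with u hu
    refine propext ?_
    change _ ≤ s ↔ _ ≤ s * (nsq w * nsq (coords u))
    rw [nsq_coords, hu, hw]
    simp [coords]
  · have := continuous_nsq
    exact (isClosed_le (by fun_prop) (by fun_prop)).measurableSet

/-- The numerical shadow of a 2×2 matrix assigns mass `1 − √(1−r²)` to the scaled
filled ellipse `rE`, where `E` has semiaxes `a = √(1+b²)` and `b = q/2`. -/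
theorem stmt_0 (q : ℝ) (hq : 0 < q)
    (M : Matrix (Fin 2) (Fin 2) ℂ) (hM : M = !![1, (q : ℂ); 0, -1])
    (b a : ℝ) (hb : b = q / 2) (ha : a = Real.sqrt (1 + b ^ 2))
    [MeasurableSpace (EuclideanSpace ℂ (Fin 2))] [BorelSpace (EuclideanSpace ℂ (Fin 2))]
    (μ : Measure (EuclideanSpace ℂ (Fin 2))) (hμ : IsUniformOnSphere μ)
    (r : ℝ) (hr0 : 0 ≤ r) (hr1 : r ≤ 1) :
    μ {u : EuclideanSpace ℂ (Fin 2) | ‖u‖ = 1 ∧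
        (qf M u).re ^ 2 / a ^ 2 + (qf M u).im ^ 2 / b ^ 2 ≤ r ^ 2}
      = ENNReal.ofReal (1 - Real.sqrt (1 - r ^ 2)) := by
  have := hμ.1
  have hb0 : 0 < b := by rw [hb]; positivity
  have ha2 : a ^ 2 = 1 + b ^ 2 := by rw [ha, Real.sq_sqrt (by positivity)]
  have ha0 : 0 < a := by rw [ha]; positivity
  have hba : b / a < 1 := by rw [div_lt_one ha0]; nlinarith
  have hba0 : 0 < b / a := by positivity
  obtain ⟨α, hα0, hα⟩ : ∃ α : ℝ, 0 ≤ α ∧ α ^ 2 = (1 - b / a) / 2 :=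
    ⟨√((1 - b / a) / 2), Real.sqrt_nonneg _, Real.sq_sqrt (by linarith)⟩
  obtain ⟨β, hβ0, hβ⟩ : ∃ β : ℝ, 0 ≤ β ∧ β ^ 2 = (1 + b / a) / 2 :=
    ⟨√((1 + b / a) / 2), Real.sqrt_nonneg _, Real.sq_sqrt (by linarith)⟩
  have hαβ : α * β = 1 / (2 * a) := by
    rw [← sq_eq_sq₀ (by positivity) (by positivity), mul_pow, hα, hβ]
    field_simp
    linear_combination ha2
  have hsum : α ^ 2 + β ^ 2 = 1 := by rw [hα, hβ]; ring
  obtain ⟨t, ht0, ht⟩ : ∃ t : ℝ, 0 ≤ t ∧ t = √(1 - r ^ 2) := ⟨_, Real.sqrt_nonneg _, rfl⟩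
  have ht2 : t ^ 2 = 1 - r ^ 2 := by rw [ht, Real.sq_sqrt (by nlinarith)]
  have ht1 : t ≤ 1 := by nlinarith
  rw [← ht]
  set P : EuclideanSpace ℂ (Fin 2) → ℝ := fun u => ‖star (α : ℂ) * u 0 + star (β : ℂ) * u 1‖ ^ 2
    with hP
  set Q : EuclideanSpace ℂ (Fin 2) → ℝ :=
    fun u => ‖star (-β : ℂ) * u 0 + star (α : ℂ) * u 1‖ ^ 2 with hQ
  have hPQ : ∀ u, ‖u‖ = 1 → P u + Q u = 1 := fun u hu => by
    have h := nsq_coords u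
    rw [hu, one_pow] at h
    simp only [nsq, coords, hP, hQ, Complex.sq_norm, Complex.normSq_apply, Complex.star_def,
      Complex.add_re, Complex.add_im, Complex.mul_re, Complex.mul_im, Complex.conj_re,
      Complex.conj_im, Complex.neg_re, Complex.neg_im, Complex.ofReal_re, Complex.ofReal_im] at h ⊢
    linear_combination (α ^ 2 + β ^ 2) * h + hsum
  have hform : ∀ u, ‖u‖ = 1 →
      (qf M u).re ^ 2 / a ^ 2 + (qf M u).im ^ 2 / b ^ 2 = 1 - (P u - Q u) ^ 2 := fun u hu => by
    have h := nsq_coords u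
    rw [hu, one_pow] at h
    have hq2 : q = 2 * b := by rw [hb]; ring
    generalize hx : 2 * ((u 0).re * (u 1).re + (u 0).im * (u 1).im) = x
    generalize hy : 2 * ((u 0).re * (u 1).im - (u 0).im * (u 1).re) = y
    generalize hz : (u 0).re ^ 2 + (u 0).im ^ 2 - (u 1).re ^ 2 - (u 1).im ^ 2 = z
    have hre : (qf M u).re = z + b * x := by
      simp [qf, hM, Fin.sum_univ_two, hq2, ← hx, ← hz]
      ring
    have him : (qf M u).im = b * y := by
      simp [qf, hM, Fin.sum_univ_two, hq2, ← hy]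
      ring
    have hdiff : P u - Q u = (x - b * z) / a := by
      have h1 : P u - Q u = (α ^ 2 - β ^ 2) * z + 2 * (α * β) * x := by
        simp only [hP, hQ, Complex.sq_norm, Complex.normSq_apply, Complex.star_def,
          Complex.add_re, Complex.add_im, Complex.mul_re, Complex.mul_im, Complex.conj_re,
          Complex.conj_im, Complex.neg_re, Complex.neg_im, Complex.ofReal_re, Complex.ofReal_im,
          ← hx, ← hz]
        ring
      rw [h1, hαβ, hα, hβ]
      field_simp
      ring
    have hxyz : x ^ 2 + y ^ 2 + z ^ 2 = 1 := by
      simp only [nsq, coords, Complex.sq_norm, Complex.normSq_apply] at h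
      have h2 := congrArg (· ^ 2) h
      simp only [one_pow] at h2
      rw [← h2, ← hx, ← hy, ← hz]
      ring
    rw [hre, him, hdiff]
    field_simp
    linear_combination a ^ 2 * hxyz - (x ^ 2 + z ^ 2) * ha2
  have hset : ({u : EuclideanSpace ℂ (Fin 2) | ‖u‖ = 1 ∧
      (qf M u).re ^ 2 / a ^ 2 + (qf M u).im ^ 2 / b ^ 2 ≤ r ^ 2} : Set _) =ᵐ[μ]
      ({u | P u ≤ (1 - t) / 2} ∪ {u | Q u ≤ (1 - t) / 2} : Set _) := by
    filter_upwards [hμ.ae_norm_eq_one] with u hu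
    refine propext ?_
    change (‖u‖ = 1 ∧ _ ≤ r ^ 2) ↔ (P u ≤ (1 - t) / 2 ∨ Q u ≤ (1 - t) / 2)
    rw [hform u hu]
    have h1 := hPQ u hu
    have h2 : t ≤ |P u - Q u| ↔ (P u ≤ (1 - t) / 2 ∨ Q u ≤ (1 - t) / 2) := by
      rw [le_abs]
      constructor <;> rintro (h | h)
      · right; linarith
      · left; linarith
      · right; linarith
      · left; linarith
    rw [← h2, ← abs_of_nonneg ht0, ← sq_le_sq]
    constructor
    · rintro ⟨-, h⟩
      linarith
    · exact fun h => ⟨hu, by linarith⟩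
  rw [measure_congr hset]
  have hs0 : 0 ≤ (1 - t) / 2 := by linarith
  have hs1 : (1 - t) / 2 < 1 := by linarith
  have hPm : μ {u | P u ≤ (1 - t) / 2} = ENNReal.ofReal ((1 - t) / 2) :=
    hμ.measure_inner_le (w := (α, β)) (by simp [nsq, hsum]) hs0 hs1
  have hQm : μ {u | Q u ≤ (1 - t) / 2} = ENNReal.ofReal ((1 - t) / 2) :=
    hμ.measure_inner_le (w := (-β, α)) (by simp [nsq, add_comm, hsum]) hs0 hs1
  rcases ht0.eq_or_lt with h0 | h0
  · rw [← h0, sub_zero, ENNReal.ofReal_one, ← measure_univ (μ := μ)]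
    apply measure_congr
    filter_upwards [hμ.ae_norm_eq_one] with u hu
    refine propext ⟨fun _ => trivial, fun _ => ?_⟩
    have h1 := hPQ u hu
    rcases le_total (P u) (1 / 2) with h | h
    · exact Or.inl h
    · exact Or.inr (show Q u ≤ 1 / 2 by linarith)
  · have hQmeas : MeasurableSet {u | Q u ≤ (1 - t) / 2} :=
      (isClosed_le (by fun_prop) (by fun_prop)).measurableSet
    rw [measure_union₀ hQmeas.nullMeasurableSet, hPm, hQm, ← ENNReal.ofReal_add hs0 hs0, add_halves]
    rw [AEDisjoint, measure_eq_zero_iff_ae_notMem]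
    filter_upwards [hμ.ae_norm_eq_one] with u hu h
    have h1 := hPQ u hu
    have h2 : P u ≤ (1 - t) / 2 := h.1
    have h3 : Q u ≤ (1 - t) / 2 := h.2
    linarith
end

section
/- Let A be a normal N×N complex matrix with eigenvalues λ₁,…,λ_N ∈ ℂ listed with algebraic multiplicity. Let μ be the uniform probability measure on the unit sphere Ω_N of ℂ^N, and let ν be the uniform probability measure on the standard simplex Δ_N = {r ∈ ℝ^N : r_k ≥ 0 for all k, Σ_k r_k = 1} (normalized (N−1)-dimensional Lebesgue/Hausdorff measure on Δ_N). Then the pushforward of μ under the map u ↦ ⟨Au,u⟩ equals the pushforward of ν under the map r ↦ Σ_{k=1}^N r_k λ_k. In particular, for every Borel set B ⊆ ℂ, P_A(B) = ν{r ∈ Δ_N : Σ_k r_k λ_k ∈ B}. -/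
open MeasureTheory Matrix

section Spectral

open Module End

variable {E : Type*} [NormedAddCommGroup E] [InnerProductSpace ℂ E] [FiniteDimensional ℂ E]
  {T : E →ₗ[ℂ] E}

theorem norm_adjoint_apply_of_commute
    (hT : LinearMap.adjoint T ∘ₗ T = T ∘ₗ LinearMap.adjoint T) (v : E) :
    ‖LinearMap.adjoint T v‖ = ‖T v‖ := by
  have h : inner ℂ (LinearMap.adjoint T v) (LinearMap.adjoint T v) = inner ℂ (T v) (T v) := by
    rw [LinearMap.adjoint_inner_left, ← LinearMap.adjoint_inner_right]
    exact congrArg (inner ℂ v) (LinearMap.congr_fun hT v).symm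
  rw [inner_self_eq_norm_sq_to_K, inner_self_eq_norm_sq_to_K] at h
  exact (sq_eq_sq₀ (norm_nonneg _) (norm_nonneg _)).1 (by exact_mod_cast h)

theorem adjoint_apply_eq_of_apply_eq
    (hT : LinearMap.adjoint T ∘ₗ T = T ∘ₗ LinearMap.adjoint T) {c : ℂ} {v : E}
    (hv : T v = c • v) : LinearMap.adjoint T v = (starRingEnd ℂ) c • v := by
  have had : LinearMap.adjoint (T - c • LinearMap.id)
      = LinearMap.adjoint T - (starRingEnd ℂ) c • LinearMap.id := by
    rw [map_sub, map_smulₛₗ, LinearMap.adjoint_id]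
  have h := norm_adjoint_apply_of_commute (T := T - c • LinearMap.id) (by
    rw [had]
    ext w
    have := LinearMap.congr_fun hT w
    simp only [LinearMap.comp_apply] at this
    simp [this, smul_sub, smul_comm c]
    abel) v
  rw [had] at h
  simpa [hv, sub_eq_zero] using h

theorem orthogonalFamily_eigenspaces_of_commute
    (hT : LinearMap.adjoint T ∘ₗ T = T ∘ₗ LinearMap.adjoint T) :
    OrthogonalFamily ℂ (fun c : Eigenvalues T => eigenspace T c)
      fun c => (eigenspace T (c : ℂ)).subtypeₗᵢ := by
  rintro c d hcd ⟨v, hv⟩ ⟨w, hw⟩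
  rw [mem_eigenspace_iff] at hv hw
  have hne : (d : ℂ) - c ≠ 0 := fun h => hcd (Subtype.ext (sub_eq_zero.1 h).symm)
  have h : inner ℂ (LinearMap.adjoint T v) w = inner ℂ v (T w) :=
    LinearMap.adjoint_inner_left _ _ _
  rw [adjoint_apply_eq_of_apply_eq hT hv, hw, inner_smul_left, inner_smul_right,
    Complex.conj_conj] at h
  have : ((d : ℂ) - c) * inner ℂ v w = 0 := by rw [sub_mul, h, sub_self]
  exact (mul_eq_zero.1 this).resolve_left hne

theorem orthogonal_iSup_eigenspace_eq_bot_of_commute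
    (hT : LinearMap.adjoint T ∘ₗ T = T ∘ₗ LinearMap.adjoint T) :
    (⨆ c : Eigenvalues T, eigenspace T (c : ℂ))ᗮ = ⊥ := by
  set p := (⨆ c : Eigenvalues T, eigenspace T (c : ℂ))ᗮ with hp
  have hmem : ∀ v, v ∈ p ↔ ∀ c : Eigenvalues T, ∀ w ∈ eigenspace T (c : ℂ), inner ℂ w v = 0 := by
    intro v
    rw [hp, ← Submodule.iInf_orthogonal]
    simp [Submodule.mem_iInf, Submodule.mem_orthogonal]
  have hinv : ∀ v ∈ p, T v ∈ p := by
    intro v hv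
    rw [hmem] at hv ⊢
    intro c w hw
    rw [← LinearMap.adjoint_inner_left,
      adjoint_apply_eq_of_apply_eq hT (mem_eigenspace_iff.1 hw), inner_smul_left, hv c w hw,
      mul_zero]
  by_contra hne
  have : Nontrivial p := Submodule.nontrivial_iff_ne_bot.2 hne
  obtain ⟨c, hc⟩ := exists_eigenvalue (T.restrict hinv)
  obtain ⟨v, hv⟩ := hc.exists_hasEigenvector
  have hv1 : T v = c • (v : E) := by
    simpa using congrArg Subtype.val (mem_eigenspace_iff.1 hv.1)
  have hv0 : (v : E) ≠ 0 := fun h => hv.2 (Subtype.ext h)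
  have hc' : HasEigenvalue T c := hasEigenvalue_of_hasEigenvector ⟨mem_eigenspace_iff.2 hv1, hv0⟩
  exact hv0 (inner_self_eq_zero.1 ((hmem v).1 v.2 ⟨c, hc'⟩ v (mem_eigenspace_iff.2 hv1)))

theorem exists_orthonormalBasis_eigenvectors_of_commute
    (hT : LinearMap.adjoint T ∘ₗ T = T ∘ₗ LinearMap.adjoint T) {n : ℕ} (hn : finrank ℂ E = n) :
    ∃ (b : OrthonormalBasis (Fin n) ℂ E) (d : Fin n → ℂ), ∀ i, T (b i) = d i • b i := by
  classical
  have hint : DirectSum.IsInternal (fun c : Eigenvalues T => eigenspace T (c : ℂ)) :=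
    (orthogonalFamily_eigenspaces_of_commute hT).isInternal_iff.2
      (orthogonal_iSup_eigenspace_eq_bot_of_commute hT)
  have horth := orthogonalFamily_eigenspaces_of_commute hT
  refine ⟨hint.subordinateOrthonormalBasis hn horth,
    fun i => ((hint.subordinateOrthonormalBasisIndex hn i horth : Eigenvalues T) : ℂ), fun i => ?_⟩
  exact mem_eigenspace_iff.1 (hint.subordinateOrthonormalBasis_subordinate hn i horth)

end Spectral

theorem exists_perm_of_prod_X_sub_C_eq {n : ℕ} {d l : Fin n → ℂ}
    (h : ∏ k, (Polynomial.X - Polynomial.C (d k)) = ∏ k, (Polynomial.X - Polynomial.C (l k))) :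
    ∃ σ : Equiv.Perm (Fin n), d ∘ σ = l := by
  classical
  have hroots (f : Fin n → ℂ) :
      (∏ k, (Polynomial.X - Polynomial.C (f k))).roots = Finset.univ.val.map f := by
    rw [← Polynomial.roots_multiset_prod_X_sub_C (Finset.univ.val.map f), Multiset.map_map]
    rfl
  have h' : Finset.univ.val.map d = Finset.univ.val.map l := by rw [← hroots, ← hroots, h]
  have hcard (c : ℂ) : Fintype.card {i // l i = c} = Fintype.card {i // d i = c} := by
    have := congrArg (Multiset.count c) h'
    rw [Multiset.count_map, Multiset.count_map] at this
    rw [Fintype.card_subtype, Fintype.card_subtype, Finset.card_def, Finset.card_def,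
      Finset.filter_val, Finset.filter_val]
    simpa only [eq_comm] using this.symm
  let e (c : ℂ) : {i // l i = c} ≃ {i // d i = c} := Fintype.equivOfCardEq (hcard c)
  refine ⟨((Equiv.sigmaFiberEquiv l).symm.trans (Equiv.sigmaCongrRight e)).trans
    (Equiv.sigmaFiberEquiv d), funext fun i => ?_⟩
  exact (e (l i) ⟨i, rfl⟩).2

theorem exists_unitary_mul_eq_mul_diagonal {n : ℕ} {A : Matrix (Fin n) (Fin n) ℂ}
    (hA : A * Aᴴ = Aᴴ * A) {l : Fin n → ℂ}
    (hl : A.charpoly = ∏ k, (Polynomial.X - Polynomial.C (l k))) :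
    ∃ U ∈ Matrix.unitaryGroup (Fin n) ℂ, A * U = U * diagonal l := by
  have key : ∀ (b : OrthonormalBasis (Fin n) ℂ (EuclideanSpace ℂ (Fin n))) (d : Fin n → ℂ),
      (∀ i, Matrix.toEuclideanLin A (b i) = d i • b i) →
      ∃ U ∈ Matrix.unitaryGroup (Fin n) ℂ, A * U = U * diagonal d := by
    intro b d hb
    refine ⟨_, (EuclideanSpace.basisFun (Fin n) ℂ).toMatrix_orthonormalBasis_mem_unitary b, ?_⟩
    ext i j
    have := congrArg (fun v : EuclideanSpace ℂ (Fin n) => v i) (hb j)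
    rw [Matrix.mul_diagonal, Matrix.mul_apply]
    simpa [Matrix.toLpLin_apply, Matrix.mulVec, dotProduct, Module.Basis.toMatrix_apply,
      mul_comm (d j)] using this
  obtain ⟨b, d, hb⟩ := exists_orthonormalBasis_eigenvectors_of_commute
    (T := Matrix.toEuclideanLin A) (n := n) (by
      rw [← Matrix.toEuclideanLin_conjTranspose_eq_adjoint]
      ext v i
      simp [Matrix.toLpLin_apply, hA]) (by simp)
  obtain ⟨U, hU, hAU⟩ := key b d hb
  have hUU : U * star U = 1 := Matrix.mem_unitaryGroup_iff.1 hU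
  have hUU' : star U * U = 1 := Matrix.mem_unitaryGroup_iff'.1 hU
  have hd : A.charpoly = ∏ k, (Polynomial.X - Polynomial.C (d k)) := by
    have : A = U * diagonal d * star U := by rw [← hAU, mul_assoc, hUU, mul_one]
    rw [this, Matrix.charpoly_mul_comm, ← mul_assoc, hUU', one_mul, Matrix.charpoly_diagonal]
  obtain ⟨σ, rfl⟩ := exists_perm_of_prod_X_sub_C_eq (hd.symm.trans hl)
  exact key (b.reindex σ.symm) (d ∘ σ) fun i => by simpa using hb (σ i)

theorem qf_eq_star_dotProduct_mulVec {ι : Type*} [Fintype ι] (A : Matrix ι ι ℂ)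
    (u : EuclideanSpace ℂ ι) : qf A u = star u.ofLp ⬝ᵥ A *ᵥ u.ofLp := by
  simp [qf, dotProduct, Matrix.mulVec, Finset.mul_sum, mul_assoc]

theorem qf_toEuclideanLin_of_mul_eq {n : ℕ} {A U : Matrix (Fin n) (Fin n) ℂ}
    (hU : U ∈ Matrix.unitaryGroup (Fin n) ℂ) {l : Fin n → ℂ} (hAU : A * U = U * diagonal l)
    (u : EuclideanSpace ℂ (Fin n)) :
    qf A (Matrix.toEuclideanLin U u) = ∑ k, ((‖u k‖ ^ 2 : ℝ) : ℂ) * l k := by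
  have hUU : Uᴴ * U = 1 := Matrix.mem_unitaryGroup_iff'.1 hU
  rw [qf_eq_star_dotProduct_mulVec, Matrix.toLpLin_apply, Matrix.star_mulVec,
    Matrix.mulVec_mulVec, hAU, ← Matrix.dotProduct_mulVec, Matrix.mulVec_mulVec, ← mul_assoc,
    hUU, one_mul]
  simp only [dotProduct, Matrix.mulVec_diagonal, Pi.star_apply]
  refine Finset.sum_congr rfl fun k _ => ?_
  rw [mul_left_comm, mul_comm, RCLike.star_def, RCLike.conj_mul]
  push_cast
  rfl

theorem exists_linearIsometryEquiv_of_mem_unitaryGroup {n : ℕ} {U : Matrix (Fin n) (Fin n) ℂ}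
    (hU : U ∈ Matrix.unitaryGroup (Fin n) ℂ) :
    ∃ L : EuclideanSpace ℂ (Fin n) ≃ₗᵢ[ℂ] EuclideanSpace ℂ (Fin n),
      ∀ u, L u = Matrix.toEuclideanLin U u := by
  have hUU : Uᴴ * U = 1 := Matrix.mem_unitaryGroup_iff'.1 hU
  have hn (u : EuclideanSpace ℂ (Fin n)) : ‖Matrix.toEuclideanLin U u‖ = ‖u‖ := by
    have h : inner ℂ (Matrix.toEuclideanLin U u) (Matrix.toEuclideanLin U u) = inner ℂ u u := by
      rw [← LinearMap.adjoint_inner_right, ← Matrix.toEuclideanLin_conjTranspose_eq_adjoint]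
      simp [Matrix.toLpLin_apply, hUU]
    rw [inner_self_eq_norm_sq_to_K, inner_self_eq_norm_sq_to_K] at h
    exact (sq_eq_sq₀ (norm_nonneg _) (norm_nonneg _)).1 (by exact_mod_cast h)
  exact ⟨LinearIsometry.toLinearIsometryEquiv ⟨Matrix.toEuclideanLin U, hn⟩ rfl, fun u => rfl⟩

theorem exists_mem_unitaryGroup_of_linearIsometryEquiv {n : ℕ}
    (L : EuclideanSpace ℂ (Fin n) ≃ₗᵢ[ℂ] EuclideanSpace ℂ (Fin n)) :
    ∃ U ∈ Matrix.unitaryGroup (Fin n) ℂ, ∀ u, L u = Matrix.toEuclideanLin U u := by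
  refine ⟨_, L.toMatrix_mem_unitaryGroup (EuclideanSpace.basisFun (Fin n) ℂ)
    (EuclideanSpace.basisFun (Fin n) ℂ), fun u => ?_⟩
  rw [Matrix.toEuclideanLin_eq_toLin_orthonormal, Matrix.toLin_toMatrix]
  rfl

theorem exists_linearIsometryEquiv_apply_eq {n : ℕ} [NeZero n]
    {s t : EuclideanSpace ℂ (Fin n)} (h : ‖t‖ = ‖s‖) :
    ∃ L : EuclideanSpace ℂ (Fin n) ≃ₗᵢ[ℂ] EuclideanSpace ℂ (Fin n), L t = s := by
  rcases eq_or_ne t 0 with rfl | ht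
  · refine ⟨LinearIsometryEquiv.refl ℂ _, ?_⟩
    rw [norm_zero] at h
    simp [norm_eq_zero.1 h.symm]
  have hb : ∀ v : EuclideanSpace ℂ (Fin n), v ≠ 0 →
      ∃ b : OrthonormalBasis (Fin n) ℂ (EuclideanSpace ℂ (Fin n)), v = (‖v‖ : ℂ) • b 0 := by
    intro v hv
    have hv' : (‖v‖ : ℂ) ≠ 0 := by simpa using hv
    have ho : Orthonormal ℂ (({0} : Set (Fin n)).domRestrict
        fun _ => ((‖v‖ : ℂ)⁻¹ • v : EuclideanSpace ℂ (Fin n))) := by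
      constructor
      · intro i
        change ‖(‖v‖ : ℂ)⁻¹ • v‖ = 1
        rw [norm_smul, norm_inv, Complex.norm_real, norm_norm,
          inv_mul_cancel₀ (norm_ne_zero_iff.2 hv)]
      · intro i j hij
        exact (hij (Subsingleton.elim _ _)).elim
    obtain ⟨b, hb⟩ := ho.exists_orthonormalBasis_extension_of_card_eq (by simp)
    exact ⟨b, by rw [hb 0 rfl, smul_smul, mul_inv_cancel₀ hv', one_smul]⟩
  have hs : s ≠ 0 := by
    rw [← norm_ne_zero_iff, ← h]
    exact norm_ne_zero_iff.2 ht
  obtain ⟨b, hb1⟩ := hb t ht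
  obtain ⟨c, hc1⟩ := hb s hs
  refine ⟨b.equiv c (Equiv.refl _), ?_⟩
  rw [hb1, map_smul, OrthonormalBasis.equiv_apply_basis, h]
  exact hc1.symm

theorem charFun_map_linearIsometryEquiv {E : Type*} [NormedAddCommGroup E]
    [InnerProductSpace ℝ E] [MeasurableSpace E] [BorelSpace E] {μ : Measure E} (L : E ≃ₗᵢ[ℝ] E)
    (hμ : μ.map L = μ) (t : E) : charFun μ (L t) = charFun μ t := by
  conv_lhs => rw [charFun_apply, ← hμ]
  rw [show (L : E → E) = L.toHomeomorph from rfl,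
    L.toHomeomorph.measurableEmbedding.integral_map]
  simp [charFun_apply]

/-- Two probability measures on the unit sphere of `ℂⁿ` that are invariant under all linear
isometries coincide. -/
theorem eq_of_map_linearIsometryEquiv_eq {n : ℕ} [NeZero n]
    {μ σ : Measure (EuclideanSpace ℂ (Fin n))} [IsProbabilityMeasure μ] [IsProbabilityMeasure σ]
    (hμs : ∀ᵐ u ∂μ, ‖u‖ = 1) (hσs : ∀ᵐ u ∂σ, ‖u‖ = 1)
    (hμ : ∀ L : EuclideanSpace ℂ (Fin n) ≃ₗᵢ[ℂ] EuclideanSpace ℂ (Fin n), μ.map L = μ)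
    (hσ : ∀ L : EuclideanSpace ℂ (Fin n) ≃ₗᵢ[ℂ] EuclideanSpace ℂ (Fin n), σ.map L = σ) :
    μ = σ := by
  have hrad : ∀ (ρ : Measure (EuclideanSpace ℂ (Fin n))),
      (∀ L : EuclideanSpace ℂ (Fin n) ≃ₗᵢ[ℂ] EuclideanSpace ℂ (Fin n), ρ.map L = ρ) →
      ∀ s t, ‖t‖ = ‖s‖ → charFun ρ s = charFun ρ t := by
    intro ρ hρ s t hst
    obtain ⟨L, rfl⟩ := exists_linearIsometryEquiv_apply_eq hst
    exact charFun_map_linearIsometryEquiv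
      (⟨L.toLinearEquiv.restrictScalars ℝ, L.norm_map⟩ :
        EuclideanSpace ℂ (Fin n) ≃ₗᵢ[ℝ] EuclideanSpace ℂ (Fin n)) (hρ L) t
  refine Measure.ext_of_charFun (funext fun t => ?_)
  have hint : ∀ (ρ τ : Measure (EuclideanSpace ℂ (Fin n))) [IsProbabilityMeasure ρ]
      [IsProbabilityMeasure τ],
      (∀ L : EuclideanSpace ℂ (Fin n) ≃ₗᵢ[ℂ] EuclideanSpace ℂ (Fin n), ρ.map L = ρ) →
      (∀ᵐ u ∂τ, ‖u‖ = 1) → ∫ u, charFun ρ (‖t‖ • u) ∂τ = charFun ρ t := by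
    intro ρ τ _ _ hρ hτ
    rw [integral_congr_ae (g := fun _ => charFun ρ t)]
    · simp
    · filter_upwards [hτ] with u hu
      exact hrad ρ hρ _ _ (by simp [norm_smul, hu])
  rw [← hint μ σ hμ hσs, ← hint σ μ hσ hμs]
  simp only [charFun_apply]
  rw [integral_integral_swap]
  · simp only [real_inner_smul_right, real_inner_comm]
  · refine Integrable.of_bound (C := 1) ?_ ?_
    · apply Continuous.aestronglyMeasurable
      fun_prop
    · refine Filter.Eventually.of_forall fun p => ?_
      rw [Function.uncurry_apply_pair, Complex.norm_exp_ofReal_mul_I]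

theorem map_pi_mul_norm_sq_volume :
    (volume : Measure ℂ).map (fun z => Real.pi * ‖z‖ ^ 2) = volume.restrict (Set.Ici 0) := by
  have hmeas : Measurable fun z : ℂ => Real.pi * ‖z‖ ^ 2 := by fun_prop
  have hIio (b : ℝ) : (volume : Measure ℂ) ((fun z => Real.pi * ‖z‖ ^ 2) ⁻¹' Set.Iio b)
      = ENNReal.ofReal b := by
    rcases le_or_gt b 0 with hb | hb
    · have : (fun z : ℂ => Real.pi * ‖z‖ ^ 2) ⁻¹' Set.Iio b = ∅ := by
        ext z
        simpa using hb.trans (by positivity)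
      rw [this, measure_empty, ENNReal.ofReal_of_nonpos hb]
    · have : (fun z : ℂ => Real.pi * ‖z‖ ^ 2) ⁻¹' Set.Iio b
          = Metric.ball 0 (Real.sqrt (b / Real.pi)) := by
        ext z
        rw [mem_ball_zero_iff, Real.lt_sqrt (norm_nonneg _), lt_div_iff₀' Real.pi_pos]
        rfl
      rw [this, Complex.volume_ball, ← ENNReal.ofReal_pow (Real.sqrt_nonneg _),
        Real.sq_sqrt (by positivity)]
      rw [show (NNReal.pi : ENNReal) = ENNReal.ofReal Real.pi by
        rw [← NNReal.coe_real_pi, ENNReal.ofReal_coe_nnreal],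
        ← ENNReal.ofReal_mul (by positivity), div_mul_cancel₀ _ Real.pi_ne_zero]
  have hIio' (b : ℝ) : (volume.restrict (Set.Ici (0 : ℝ))) (Set.Iio b) = ENNReal.ofReal b := by
    rw [Measure.restrict_apply measurableSet_Iio, Set.Iio_inter_Ici, Real.volume_Ico, sub_zero]
  refine Measure.ext_of_generateFrom_of_iUnion (Set.range Set.Iio) (fun n : ℕ => Set.Iio (n : ℝ))
    (borel_eq_generateFrom_Iio ℝ ▸ BorelSpace.measurable_eq) isPiSystem_Iio ?_ ?_ ?_ ?_
  · exact Set.iUnion_eq_univ_iff.2 fun x => exists_nat_gt x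
  · exact fun n => ⟨_, rfl⟩
  · intro n
    rw [Measure.map_apply hmeas measurableSet_Iio, hIio]
    exact ENNReal.ofReal_ne_top
  · rintro _ ⟨b, rfl⟩
    rw [Measure.map_apply hmeas measurableSet_Iio, hIio, hIio']

theorem map_pi_mul_norm_sq_volume_pi (n : ℕ) :
    (volume : Measure (Fin n → ℂ)).map (fun z k => Real.pi * ‖z k‖ ^ 2)
      = volume.restrict {x | ∀ k, 0 ≤ x k} := by
  have : SigmaFinite ((volume : Measure ℂ).map (fun z => Real.pi * ‖z‖ ^ 2)) := by
    rw [map_pi_mul_norm_sq_volume]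
    infer_instance
  rw [volume_pi, Measure.pi_map_pi (f := fun _ z => Real.pi * ‖z‖ ^ 2)
    (fun _ => by fun_prop), map_pi_mul_norm_sq_volume, ← Measure.restrict_pi_pi]
  congr 1
  ext x
  simp [Pi.le_def]

/-- Normalizing the coordinate sum of a uniformly distributed point of a truncated orthant yields
a multiple of the Hausdorff measure on the standard simplex. -/
theorem exists_map_inv_sum_smul_eq_smul_hausdorffMeasure {n : ℕ} [NeZero n]
    (m : Measure (EuclideanSpace ℝ (Fin n))) [m.IsAddHaarMeasure] (r : ℝ) :
    ∃ c : ENNReal, (m.restrict {x | (∀ k, 0 ≤ x k) ∧ ∑ k, x k < r}).map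
        (fun x => (∑ k, x k)⁻¹ • x)
      = c • (μH[(n : ℝ) - 1]).restrict
        {x : EuclideanSpace ℝ (Fin n) | (∀ k, 0 ≤ x k) ∧ ∑ k, x k = 1} := by
  obtain ⟨sumL, hsumL⟩ : ∃ f : EuclideanSpace ℝ (Fin n) →L[ℝ] ℝ, ∀ x, f x = ∑ k, x k :=
    ⟨∑ k, EuclideanSpace.proj k, fun x => by rw [_root_.sum_apply]; rfl⟩
  obtain ⟨c₀, hc₀⟩ : ∃ c : EuclideanSpace ℝ (Fin n), sumL c = 1 :=
    ⟨EuclideanSpace.single 0 1, by simp [hsumL]⟩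
  let V : Submodule ℝ (EuclideanSpace ℝ (Fin n)) := LinearMap.ker sumL.toLinearMap
  have hV (v : V) : sumL v = 0 := v.2
  have hfin : (Module.finrank ℝ V : ℝ) = (n : ℝ) - 1 := by
    have h1 := sumL.toLinearMap.finrank_range_add_finrank_ker
    have h2 : LinearMap.range sumL.toLinearMap = ⊤ :=
      LinearMap.range_eq_top.2 fun a => ⟨a • c₀, by simp [hc₀]⟩
    rw [h2, finrank_top, Module.finrank_self, finrank_euclideanSpace_fin] at h1
    rw [eq_sub_iff_add_eq, add_comm]
    exact_mod_cast h1
  let ψL : (V × ℝ) ≃ₗ[ℝ] EuclideanSpace ℝ (Fin n) :=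
    { toFun := fun p => p.1 + p.2 • c₀
      invFun := fun x => (⟨x - sumL x • c₀, by simp [V, hc₀]⟩, sumL x)
      map_add' := fun p q => by simp [add_smul]; abel
      map_smul' := fun a p => by simp [mul_smul]
      left_inv := fun p => by ext <;> simp [hV, hc₀]
      right_inv := fun x => by simp }
  let ψ : (V × ℝ) ≃L[ℝ] EuclideanSpace ℝ (Fin n) := ψL.toContinuousLinearEquiv
  have hψ (v : V) (t : ℝ) : ψ (v, t) = v + t • c₀ := rfl
  have hψs (v : V) (t : ℝ) : sumL (ψ (v, t)) = t := by simp [hψ, hV, hc₀]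
  let μV : Measure V := μH[Module.finrank ℝ V]
  have hHaar : ((μV.prod volume).map ψ).IsAddHaarMeasure := ψ.isAddHaarMeasure_map _
  have hm := Measure.isAddLeftInvariant_eq_smul m ((μV.prod volume).map ψ)
  set κ := m.addHaarScalarFactor ((μV.prod volume).map ψ)
  set S : Set (EuclideanSpace ℝ (Fin n)) := {x | (∀ k, 0 ≤ x k) ∧ ∑ k, x k = 1} with hS
  let d := Module.finrank ℝ V
  refine ⟨κ * ∫⁻ t, (Set.Ioo 0 r).indicator (fun t => ENNReal.ofReal (t ^ d)) t, ?_⟩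
  have hmeasN : Measurable fun x : EuclideanSpace ℝ (Fin n) => (∑ k, x k)⁻¹ • x := by fun_prop
  have hQ : MeasurableSet {x : EuclideanSpace ℝ (Fin n) | (∀ k, 0 ≤ x k) ∧ ∑ k, x k < r} := by
    refine MeasurableSet.inter ?_ (measurableSet_lt
      (f := fun x : EuclideanSpace ℝ (Fin n) => ∑ k, x k)
      (g := fun _ => r) (by fun_prop) (by fun_prop))
    change MeasurableSet {x : EuclideanSpace ℝ (Fin n) | ∀ k, 0 ≤ x k}
    rw [Set.ofPred_forall]
    exact MeasurableSet.iInter fun k => measurableSet_le (f := fun _ => (0 : ℝ))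
      (g := fun x : EuclideanSpace ℝ (Fin n) => x k) (by fun_prop) (by fun_prop)
  ext B hB
  rw [Measure.map_apply hmeasN hB, Measure.restrict_apply (hmeasN hB), hm, Measure.smul_apply,
    Measure.map_apply ψ.continuous.measurable ((hmeasN hB).inter hQ),
    Measure.prod_apply_symm (ψ.continuous.measurable ((hmeasN hB).inter hQ)),
    Measure.smul_apply, Measure.restrict_apply hB, smul_eq_mul, mul_assoc]
  have hiso : Isometry fun v : V => (v : EuclideanSpace ℝ (Fin n)) + c₀ :=
    (IsometryEquiv.addRight c₀).isometry.comp isometry_subtype_coe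
  have hBS : μV ((fun v : V => (v : EuclideanSpace ℝ (Fin n)) + c₀) ⁻¹' (B ∩ S))
      = μH[(n : ℝ) - 1] (B ∩ S) := by
    rw [hiso.hausdorffMeasure_preimage (Or.inl (Nat.cast_nonneg _)), hfin,
      Set.inter_eq_left.2]
    rintro x ⟨-, hx⟩
    refine ⟨⟨x - c₀, ?_⟩, by simp⟩
    have : sumL x = 1 := (hsumL x).trans hx.2
    simp [V, hc₀, this]
  rw [← lintegral_mul_const _ (Measurable.indicator (by fun_prop) measurableSet_Ioo)]
  congr 1
  refine lintegral_congr_ae ?_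
  filter_upwards [Measure.ae_ne volume (0 : ℝ)] with t ht
  by_cases htr : t ∈ Set.Ioo 0 r
  · have ht0 : 0 < t := htr.1
    rw [Set.indicator_of_mem htr, ← hBS]
    have hset : (fun v => (v, t)) ⁻¹' (ψ ⁻¹'
          ((fun x : EuclideanSpace ℝ (Fin n) => (∑ k, x k)⁻¹ • x) ⁻¹' B ∩
          {x | (∀ k, 0 ≤ x k) ∧ ∑ k, x k < r}))
        = (fun v : V => t⁻¹ • v) ⁻¹'
          ((fun v : V => (v : EuclideanSpace ℝ (Fin n)) + c₀) ⁻¹' (B ∩ S)) := by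
      ext v
      have hx := hψs v t
      have hy : t⁻¹ • ψ (v, t) = ((t⁻¹ • v : V) : EuclideanSpace ℝ (Fin n)) + c₀ := by
        simp [hψ, smul_add, smul_smul, ht]
      have hy' : sumL (t⁻¹ • ψ (v, t)) = 1 := by simp [hx, ht]
      simp only [Set.mem_preimage, Set.mem_inter_iff, ← hy, hS, Set.mem_ofPred_eq, ← hsumL, hx, hy',
        htr.2, and_true]
      refine and_congr_right fun _ => forall_congr' fun k => ?_
      simp [ht0]
    rw [hset, Measure.addHaar_preimage_smul _ (inv_ne_zero ht), inv_pow, inv_inv,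
      abs_of_pos (pow_pos ht0 _)]
  · rw [Set.indicator_of_notMem htr, zero_mul]
    convert! measure_empty (μ := μV)
    refine Set.eq_empty_of_forall_notMem fun v hv => htr ?_
    have hx := hψs v t
    obtain ⟨-, hv0, hvr⟩ := hv
    rw [← hsumL, hx] at hvr
    refine ⟨lt_of_le_of_ne ?_ ht.symm, hvr⟩
    rw [← hx, hsumL]
    exact Finset.sum_nonneg fun k _ => hv0 k

theorem map_linearIsometryEquiv_eq_of_isAddHaarMeasure {n : ℕ}
    (m : Measure (EuclideanSpace ℂ (Fin n))) [m.IsAddHaarMeasure]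
    (L : EuclideanSpace ℂ (Fin n) ≃ₗᵢ[ℂ] EuclideanSpace ℂ (Fin n)) : m.map L = m := by
  have hL := (⟨L.toLinearEquiv.restrictScalars ℝ, L.norm_map⟩ :
    EuclideanSpace ℂ (Fin n) ≃ₗᵢ[ℝ] EuclideanSpace ℂ (Fin n)).measurePreserving.map_eq
  rw [Measure.isAddLeftInvariant_eq_smul m volume, Measure.map_smul]
  exact congrArg _ hL

/-- An isometry-invariant probability measure on the unit sphere of `ℂⁿ` is a multiple of the
radial projection of Lebesgue measure on the unit ball. -/
theorem exists_eq_smul_map_normalize {n : ℕ} [NeZero n]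
    {μ : Measure (EuclideanSpace ℂ (Fin n))} [IsProbabilityMeasure μ]
    (hμs : ∀ᵐ u ∂μ, ‖u‖ = 1)
    (hμ : ∀ L : EuclideanSpace ℂ (Fin n) ≃ₗᵢ[ℂ] EuclideanSpace ℂ (Fin n), μ.map L = μ)
    (m : Measure (EuclideanSpace ℂ (Fin n))) [m.IsAddHaarMeasure] :
    ∃ c : ENNReal, μ = c • (m.restrict (Metric.ball 0 1)).map (fun z => (‖z‖ : ℂ)⁻¹ • z) := by
  have hmeas : Measurable fun z : EuclideanSpace ℂ (Fin n) => (‖z‖ : ℂ)⁻¹ • z := by fun_prop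
  set σ := (m.restrict (Metric.ball 0 1)).map
    (fun z : EuclideanSpace ℂ (Fin n) => (‖z‖ : ℂ)⁻¹ • z) with hσ
  have huniv : σ Set.univ = m (Metric.ball 0 1) := by
    rw [hσ, Measure.map_apply hmeas MeasurableSet.univ, Set.preimage_univ,
      Measure.restrict_apply_univ]
  have hprob : IsProbabilityMeasure ((m (Metric.ball 0 1))⁻¹ • σ) := by
    constructor
    rw [Measure.smul_apply, smul_eq_mul, huniv]
    exact ENNReal.inv_mul_cancel (Metric.measure_ball_pos m 0 one_pos).ne' measure_ball_lt_top.ne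
  refine ⟨_, eq_of_map_linearIsometryEquiv_eq (σ := (m (Metric.ball 0 1))⁻¹ • σ) hμs ?_ hμ ?_⟩
  · refine Measure.ae_smul_measure ?_ _
    rw [hσ, ae_map_iff hmeas.aemeasurable (measurableSet_eq_fun (by fun_prop) (by fun_prop))]
    filter_upwards [ae_restrict_of_ae (Measure.ae_ne m 0)] with z hz
    rw [norm_smul, norm_inv, Complex.norm_real, norm_norm, inv_mul_cancel₀ (norm_ne_zero_iff.2 hz)]
  · intro L
    have hLm : Measurable L := L.continuous.measurable
    have hball : (m.restrict (Metric.ball 0 1)).map L = m.restrict (Metric.ball 0 1) := by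
      have := Measure.restrict_map (μ := m) hLm (s := Metric.ball 0 1) measurableSet_ball
      rw [map_linearIsometryEquiv_eq_of_isAddHaarMeasure, L.preimage_ball, map_zero] at this
      exact this.symm
    rw [Measure.map_smul]
    congr 1
    conv_rhs => rw [hσ, ← hball]
    rw [hσ, Measure.map_map hLm hmeas, Measure.map_map hmeas hLm]
    congr 1
    ext z : 1
    simp

/-- The squared moduli of the coordinates of a uniformly distributed point of the unit sphere of
`ℂⁿ` are distributed according to a multiple of the Hausdorff measure on the standard simplex. -/
theorem exists_map_norm_sq_eq_smul_hausdorffMeasure {n : ℕ} [NeZero n]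
    {μ : Measure (EuclideanSpace ℂ (Fin n))} [IsProbabilityMeasure μ]
    (hμs : ∀ᵐ u ∂μ, ‖u‖ = 1)
    (hμ : ∀ L : EuclideanSpace ℂ (Fin n) ≃ₗᵢ[ℂ] EuclideanSpace ℂ (Fin n), μ.map L = μ) :
    ∃ c : ENNReal, μ.map (fun u => (WithLp.toLp 2 fun k => ‖u k‖ ^ 2 : EuclideanSpace ℝ (Fin n)))
      = c • (μH[(n : ℝ) - 1]).restrict
        {x : EuclideanSpace ℝ (Fin n) | (∀ k, 0 ≤ x k) ∧ ∑ k, x k = 1} := by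
  let m : Measure (EuclideanSpace ℂ (Fin n)) := (volume : Measure (Fin n → ℂ)).map (WithLp.toLp 2)
  have hm : m.IsAddHaarMeasure :=
    (PiLp.continuousLinearEquiv 2 ℝ fun _ : Fin n => ℂ).symm.isAddHaarMeasure_map _
  obtain ⟨c, hc⟩ := exists_eq_smul_map_normalize hμs hμ m
  obtain ⟨c', hc'⟩ := exists_map_inv_sum_smul_eq_smul_hausdorffMeasure
    (volume : Measure (EuclideanSpace ℝ (Fin n))) Real.pi
  refine ⟨c * c', ?_⟩
  set Q := {x : EuclideanSpace ℝ (Fin n) | (∀ k, 0 ≤ x k) ∧ ∑ k, x k < Real.pi} with hQ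
  set P := {x : EuclideanSpace ℝ (Fin n) | ∀ k, 0 ≤ x k} with hP
  have hPm : MeasurableSet P := by
    rw [hP, Set.ofPred_forall]
    exact MeasurableSet.iInter fun k => measurableSet_le (by fun_prop) (by fun_prop)
  have hQm : MeasurableSet Q :=
    hPm.inter (measurableSet_lt (f := fun x : EuclideanSpace ℝ (Fin n) => ∑ k, x k)
      (g := fun _ => Real.pi) (by fun_prop) (by fun_prop))
  let T : EuclideanSpace ℂ (Fin n) → EuclideanSpace ℝ (Fin n) :=
    fun z => WithLp.toLp 2 fun k => Real.pi * ‖z k‖ ^ 2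
  have hT : Measurable T := by fun_prop
  have hmT : m.map T = volume.restrict P := by
    have hpre : {x : Fin n → ℝ | ∀ k, 0 ≤ x k} = WithLp.toLp 2 ⁻¹' P := rfl
    have h := congrArg (Measure.map (WithLp.toLp 2 : (Fin n → ℝ) → EuclideanSpace ℝ (Fin n)))
      (map_pi_mul_norm_sq_volume_pi n)
    rw [Measure.map_map (by fun_prop) (by fun_prop), hpre,
      ← Measure.restrict_map (by fun_prop) hPm, (PiLp.volume_preserving_toLp (Fin n)).map_eq] at h
    rw [← h]
    exact Measure.map_map hT (by fun_prop)
  have hTQ : T ⁻¹' Q = Metric.ball 0 1 := by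
    ext z
    have h1 : ∑ k, Real.pi * ‖z k‖ ^ 2 = Real.pi * ‖z‖ ^ 2 := by
      rw [← Finset.mul_sum, EuclideanSpace.norm_sq_eq]
    have h2 : ∀ k, 0 ≤ Real.pi * ‖z k‖ ^ 2 := fun k => by positivity
    rw [mem_ball_zero_iff]
    simp only [T, hQ, Set.mem_preimage, Set.mem_ofPred_eq, h1, h2, implies_true, true_and]
    rw [mul_lt_iff_lt_one_right Real.pi_pos, sq_lt_one_iff₀ (norm_nonneg _)]
  have hball : (m.restrict (Metric.ball 0 1)).map T = volume.restrict Q := by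
    rw [← hTQ, ← Measure.restrict_map hT hQm, hmT, Measure.restrict_restrict hQm,
      Set.inter_eq_left.2 fun x hx => hx.1]
  rw [hc, Measure.map_smul, Measure.map_map (by fun_prop) (by fun_prop), mul_smul, ← hc', ← hball,
    Measure.map_map (by fun_prop) hT]
  congr 2
  ext z k
  have h1 : ∑ k, Real.pi * ‖z k‖ ^ 2 = Real.pi * ‖z‖ ^ 2 := by
    rw [← Finset.mul_sum, EuclideanSpace.norm_sq_eq]
  simp only [Function.comp_apply, T, h1, PiLp.smul_apply, norm_mul, norm_inv, Complex.norm_real,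
    norm_norm, smul_eq_mul]
  rw [mul_inv, mul_pow, inv_pow, mul_mul_mul_comm, inv_mul_cancel₀ Real.pi_ne_zero, one_mul]

/-- For a normal matrix `A` with eigenvalues `λ₁,…,λ_N` (with multiplicity), the numerical
shadow equals the pushforward of the uniform measure on the standard simplex `Δ_N`
(normalized `(N−1)`-dimensional Hausdorff measure) under `r ↦ ∑ r_k λ_k`. -/
theorem stmt_1 (N : ℕ) (hN : 1 ≤ N)
    (A : Matrix (Fin N) (Fin N) ℂ) (hnormal : A * Aᴴ = Aᴴ * A)
    (lam : Fin N → ℂ)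
    (hlam : A.charpoly = ∏ k, (Polynomial.X - Polynomial.C (lam k)))
    [MeasurableSpace (EuclideanSpace ℂ (Fin N))] [BorelSpace (EuclideanSpace ℂ (Fin N))]
    (μ : Measure (EuclideanSpace ℂ (Fin N))) (hμ : IsUniformOnSphere μ)
    (S : Set (EuclideanSpace ℝ (Fin N)))
    (hS : S = {x : EuclideanSpace ℝ (Fin N) | (∀ k, 0 ≤ x k) ∧ ∑ k, x k = 1})
    (ν : Measure (EuclideanSpace ℝ (Fin N)))
    (hν : ν = (μH[(N : ℝ) - 1] S)⁻¹ • (μH[(N : ℝ) - 1]).restrict S) :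
    μ.map (qf A) = ν.map (fun x => ∑ k, (x k : ℂ) * lam k) := by
  have hinst : ‹MeasurableSpace (EuclideanSpace ℂ (Fin N))›
      = WithLp.measurableSpace 2 (Fin N → ℂ) :=
    BorelSpace.measurable_eq.trans
      (PiLp.borelSpace (X := fun _ : Fin N => ℂ) 2).measurable_eq.symm
  subst hinst
  have : NeZero N := ⟨by omega⟩
  obtain ⟨hprob, hsphere, hinv⟩ := hμ
  obtain ⟨U, hU, hAU⟩ := exists_unitary_mul_eq_mul_diagonal hnormal hlam
  have hμs : ∀ᵐ u ∂μ, ‖u‖ = 1 := by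
    filter_upwards [(mem_ae_iff_prob_eq_one
      Metric.isClosed_sphere.measurableSet).2 hsphere] with u hu
    exact mem_sphere_zero_iff_norm.1 hu
  have hμL : ∀ L : EuclideanSpace ℂ (Fin N) ≃ₗᵢ[ℂ] EuclideanSpace ℂ (Fin N), μ.map L = μ := by
    intro L
    obtain ⟨W, hW, hLW⟩ := exists_mem_unitaryGroup_of_linearIsometryEquiv L
    rw [funext hLW]
    exact hinv W hW
  obtain ⟨c, hc⟩ := exists_map_norm_sq_eq_smul_hausdorffMeasure hμs hμL
  rw [← hS] at hc
  have hTm : Measurable fun u : EuclideanSpace ℂ (Fin N) =>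
      (WithLp.toLp 2 fun k => ‖u k‖ ^ 2 : EuclideanSpace ℝ (Fin N)) := by fun_prop
  have hcν : c • (μH[(N : ℝ) - 1]).restrict S = ν := by
    have h1 := congrArg (fun ρ => ρ Set.univ) hc
    simp only [Measure.map_apply hTm MeasurableSet.univ, Set.preimage_univ, measure_univ,
      Measure.smul_apply, Measure.restrict_apply_univ, smul_eq_mul] at h1
    rw [hν, ENNReal.eq_inv_of_mul_eq_one_left h1.symm]
  have hqf : Measurable (qf A) := by
    unfold qf
    fun_prop
  have hUm : Measurable fun u => Matrix.toEuclideanLin U u :=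
    (LinearMap.continuous_of_finiteDimensional _).measurable
  rw [← hinv U hU, Measure.map_map hqf hUm, ← hcν, ← hc, Measure.map_map (by fun_prop) hTm]
  congr 1
  ext u : 1
  exact qf_toEuclideanLin_of_mul_eq hU hAU u
end

section
/- Let A and B be N×N complex matrices and let μ be the uniform probability measure on the unit sphere Ω_N of ℂ^N. Then the numerical shadows of A and B coincide (i.e. the pushforward of μ under u ↦ ⟨Au,u⟩ equals the pushforward of μ under u ↦ ⟨Bu,u⟩) if and only if det(I − sA − tA*) = det(I − sB − tB*) for all real s and t (equivalently, as polynomials in s,t). -/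
open MeasureTheory Matrix

section UnitaryInvariance

variable {ι : Type*} [Fintype ι]

lemma qf_eq_dotProduct (A : Matrix ι ι ℂ) (u : EuclideanSpace ℂ ι) :
    qf A u = star u.ofLp ⬝ᵥ (A *ᵥ u.ofLp) := by
  simp [qf, dotProduct, mulVec, Finset.mul_sum, mul_assoc]

lemma continuous_qf (A : Matrix ι ι ℂ) : Continuous (qf A) := by
  unfold qf
  fun_prop

lemma qf_real_smul (A : Matrix ι ι ℂ) (r : ℝ) (u : EuclideanSpace ℂ ι) :
    qf A (r • u) = (r : ℂ) ^ 2 * qf A u := by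
  simp only [qf, PiLp.smul_apply, Complex.real_smul, map_mul, Complex.conj_ofReal, Finset.mul_sum]
  refine Finset.sum_congr rfl fun i _ => Finset.sum_congr rfl fun j _ => ?_
  ring

lemma qf_smul_add_conj_smul (A : Matrix ι ι ℂ) (z : ℂ) (u : EuclideanSpace ℂ ι) :
    qf (z • A + (starRingEnd ℂ) z • Aᴴ) u = ((2 * (z * qf A u).re : ℝ) : ℂ) := by
  rw [Complex.ofReal_mul, Complex.ofReal_ofNat, Complex.re_eq_add_conj,
    mul_div_cancel₀ _ two_ne_zero]
  simp only [qf, map_mul, map_sum, Finset.mul_sum, Matrix.add_apply, Matrix.smul_apply,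
    conjTranspose_apply, mul_add, add_mul, Finset.sum_add_distrib, Complex.conj_conj, smul_eq_mul]
  congr 1
  · refine Finset.sum_congr rfl fun i _ => Finset.sum_congr rfl fun j _ => ?_
    ring
  · rw [Finset.sum_comm]
    refine Finset.sum_congr rfl fun i _ => Finset.sum_congr rfl fun j _ => ?_
    simp only [RCLike.star_def]
    ring

lemma real_inner_eq_re_inner_euclideanSpace (x y : EuclideanSpace ℂ ι) :
    inner ℝ x y = (inner ℂ x y).re := by
  simp [PiLp.inner_apply, Complex.inner]

variable [DecidableEq ι]

lemma qf_diagonal (d : ι → ℂ) (u : EuclideanSpace ℂ ι) :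
    qf (diagonal d) u = ∑ i, d i * ((‖u i‖ ^ 2 : ℝ) : ℂ) := by
  simp only [qf, diagonal_apply, mul_ite, mul_zero, ite_mul, zero_mul, Finset.sum_ite_eq,
    Finset.mem_univ, if_true]
  refine Finset.sum_congr rfl fun i _ => ?_
  rw [mul_comm _ (d i), mul_assoc, Complex.conj_mul', Complex.ofReal_pow]

lemma qf_toEuclideanLin (A U : Matrix ι ι ℂ) (u : EuclideanSpace ℂ ι) :
    qf A (toEuclideanLin U u) = qf (Uᴴ * A * U) u := by
  simp only [qf_eq_dotProduct, toLpLin_apply, star_mulVec, ← mulVec_mulVec, ← dotProduct_mulVec]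

lemma continuous_toEuclideanLin (U : Matrix ι ι ℂ) : Continuous fun u => toEuclideanLin U u :=
  (toEuclideanLin U).continuous_of_finiteDimensional

lemma inner_toEuclideanLin_of_mem_unitaryGroup {U : Matrix ι ι ℂ} (hU : U ∈ unitaryGroup ι ℂ)
    (x y : EuclideanSpace ℂ ι) :
    inner ℂ (toEuclideanLin U x) (toEuclideanLin U y) = inner ℂ x y := by
  rw [← LinearMap.adjoint_inner_right, ← toEuclideanLin_conjTranspose_eq_adjoint]
  congr 1
  have : Uᴴ * U = 1 := mem_unitaryGroup_iff'.1 hU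
  ext i
  simp [toLpLin_apply, this]

lemma LinearIsometry.exists_unitary_toEuclideanLin
    (L : EuclideanSpace ℂ ι →ₗᵢ[ℂ] EuclideanSpace ℂ ι) :
    ∃ U ∈ unitaryGroup ι ℂ, ∀ x, toEuclideanLin U x = L x := by
  refine ⟨toEuclideanLin.symm L.toLinearMap, ?_, fun x => by simp⟩
  rw [mem_unitaryGroup_iff', star_eq_conjTranspose]
  apply toEuclideanLin.injective
  refine LinearMap.ext fun x => ext_inner_left ℂ fun y => ?_
  rw [toLpLin_mul_same, LinearMap.comp_apply, toEuclideanLin_conjTranspose_eq_adjoint,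
    LinearMap.adjoint_inner_right]
  simp

lemma exists_unitary_toEuclideanLin_eq {x y : EuclideanSpace ℂ ι} (h : ‖x‖ = ‖y‖) :
    ∃ U ∈ unitaryGroup ι ℂ, toEuclideanLin U x = y := by
  rcases eq_or_ne x 0 with rfl | hx
  · exact ⟨1, one_mem _, by simp [norm_eq_zero.1 (h.symm.trans norm_zero)]⟩
  have hx0 : ‖x‖ ≠ 0 := norm_ne_zero_iff.2 hx
  have hu : ‖((‖x‖ : ℂ)⁻¹) • x‖ = 1 := by simp [norm_smul, hx0]
  have hv : ‖((‖x‖ : ℂ)⁻¹) • y‖ = 1 := by rw [norm_smul, ← h]; simp [hx0]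
  set u := ((‖x‖ : ℂ)⁻¹) • x with hu_def
  set v := ((‖x‖ : ℂ)⁻¹) • y with hv_def
  let e := LinearIsometryEquiv.toSpanUnitSingleton (𝕜 := ℂ) u hu
  let L := (LinearIsometryEquiv.toSpanUnitSingleton (𝕜 := ℂ) v hv).toLinearIsometry.comp
    e.symm.toLinearIsometry
  obtain ⟨U, hU, hUL⟩ := LinearIsometry.exists_unitary_toEuclideanLin
    (((ℂ ∙ v).subtypeₗᵢ.comp L).extend)
  refine ⟨U, hU, ?_⟩
  have key : toEuclideanLin U u = v := by
    have h1 : ((e 1 : (ℂ ∙ u)) : EuclideanSpace ℂ ι) = u := by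
      simp [e, LinearIsometryEquiv.toSpanUnitSingleton_apply]
    have h2 := LinearIsometry.extend_apply ((ℂ ∙ v).subtypeₗᵢ.comp L) (e 1)
    rw [h1] at h2
    rw [hUL, h2]
    simp [L, LinearIsometryEquiv.toSpanUnitSingleton_apply]
  have hc : (‖x‖ : ℂ)⁻¹ ≠ 0 := by simpa using hx0
  rw [hu_def, hv_def, map_smul] at key
  exact smul_right_injective _ hc key

end UnitaryInvariance

section CharFun

variable {ι : Type*} [Fintype ι] [DecidableEq ι]
  [MeasurableSpace (EuclideanSpace ℂ ι)] [BorelSpace (EuclideanSpace ℂ ι)]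
  {μ ν : Measure (EuclideanSpace ℂ ι)}

lemma charFun_eq_of_norm_eq
    (hμ : ∀ U ∈ unitaryGroup ι ℂ, μ.map (fun u => toEuclideanLin U u) = μ)
    {x y : EuclideanSpace ℂ ι} (h : ‖x‖ = ‖y‖) : charFun μ x = charFun μ y := by
  obtain ⟨U, hU, rfl⟩ := exists_unitary_toEuclideanLin_eq h
  rw [← hμ U hU, charFun_apply (μ := μ.map _) (toEuclideanLin U x),
    integral_map (continuous_toEuclideanLin U).aemeasurable (by fun_prop), hμ U hU, charFun_apply]
  simp only [real_inner_eq_re_inner_euclideanSpace, inner_toEuclideanLin_of_mem_unitaryGroup hU]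

lemma map_toEuclideanLin_of_charFun_eq [IsFiniteMeasure μ]
    (hμ : ∀ x y, ‖x‖ = ‖y‖ → charFun μ x = charFun μ y)
    {U : Matrix ι ι ℂ} (hU : U ∈ unitaryGroup ι ℂ) :
    μ.map (fun u => toEuclideanLin U u) = μ := by
  refine Measure.ext_of_charFun (funext fun y => ?_)
  have hadj (x : EuclideanSpace ℂ ι) :
      inner ℝ (toEuclideanLin U x) y = inner ℝ x (toEuclideanLin Uᴴ y) := by
    rw [real_inner_eq_re_inner_euclideanSpace, real_inner_eq_re_inner_euclideanSpace,
      toEuclideanLin_conjTranspose_eq_adjoint, LinearMap.adjoint_inner_right]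
  rw [charFun_apply, integral_map (continuous_toEuclideanLin U).aemeasurable (by fun_prop)]
  simp only [hadj]
  rw [← charFun_apply]
  refine hμ _ _ ?_
  rw [@norm_eq_sqrt_re_inner ℂ, inner_toEuclideanLin_of_mem_unitaryGroup (U := Uᴴ)
    (Unitary.star_mem hU), ← @norm_eq_sqrt_re_inner ℂ]

/-- Polar decomposition: the radial and angular parts of a unitarily invariant measure `ν` are
independent, and the angular part may be taken from any invariant probability on the sphere. -/
lemma map_norm_smul_prod_eq [IsProbabilityMeasure μ] [IsFiniteMeasure ν]
    (hμ : ∀ U ∈ unitaryGroup ι ℂ, μ.map (fun u => toEuclideanLin U u) = μ)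
    (hμ1 : ∀ᵐ u ∂μ, ‖u‖ = 1)
    (hν : ∀ U ∈ unitaryGroup ι ℂ, ν.map (fun u => toEuclideanLin U u) = ν) :
    (ν.prod μ).map (fun p => ‖p.1‖ • p.2) = ν := by
  have h_int (x : EuclideanSpace ℂ ι) {f : EuclideanSpace ℂ ι × EuclideanSpace ℂ ι → ℝ}
      (hf : Continuous f) : Integrable (fun p => Complex.exp (f p * Complex.I)) (ν.prod μ) :=
    Integrable.of_bound (by fun_prop) 1 (by simp [Complex.norm_exp_ofReal_mul_I])
  refine Measure.ext_of_charFun (funext fun x => ?_)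
  calc charFun ((ν.prod μ).map (fun p => ‖p.1‖ • p.2)) x
      = ∫ g, ∫ u, Complex.exp (inner ℝ (‖g‖ • u) x * Complex.I) ∂μ ∂ν := by
        rw [charFun_apply, integral_map (by fun_prop) (by fun_prop),
          integral_prod _ (h_int x (by fun_prop))]
    _ = ∫ g, charFun μ (‖g‖ • x) ∂ν := by
        simp only [charFun_apply, real_inner_smul_left, real_inner_smul_right]
    _ = ∫ g, charFun μ (‖x‖ • g) ∂ν := by
        refine integral_congr_ae (.of_forall fun g => charFun_eq_of_norm_eq hμ ?_)
        simp [norm_smul, mul_comm]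
    _ = ∫ g, ∫ u, Complex.exp (inner ℝ u (‖x‖ • g) * Complex.I) ∂μ ∂ν := by
        simp only [charFun_apply]
    _ = ∫ u, ∫ g, Complex.exp (inner ℝ u (‖x‖ • g) * Complex.I) ∂ν ∂μ :=
        integral_integral_swap (h_int x (by fun_prop))
    _ = ∫ u, charFun ν (‖x‖ • u) ∂μ := by
        simp only [charFun_apply, real_inner_smul_right, real_inner_comm]
    _ = ∫ _, charFun ν x ∂μ := by
        refine integral_congr_ae (hμ1.mono fun u hu => charFun_eq_of_norm_eq hν ?_)
        simp [norm_smul, hu]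
    _ = charFun ν x := by simp

lemma integral_cexp_qf_eq_of_map_qf_eq [IsProbabilityMeasure μ] [IsFiniteMeasure ν]
    (hμ : ∀ U ∈ unitaryGroup ι ℂ, μ.map (fun u => toEuclideanLin U u) = μ)
    (hμ1 : ∀ᵐ u ∂μ, ‖u‖ = 1)
    (hν : ∀ U ∈ unitaryGroup ι ℂ, ν.map (fun u => toEuclideanLin U u) = ν)
    {H K : Matrix ι ι ℂ} (h : μ.map (qf H) = μ.map (qf K)) :
    ∫ g, Complex.exp ((qf H g).re * Complex.I) ∂ν
      = ∫ g, Complex.exp ((qf K g).re * Complex.I) ∂ν := by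
  have key (M : Matrix ι ι ℂ) : ∫ g, Complex.exp ((qf M g).re * Complex.I) ∂ν
      = ∫ g, ∫ z, Complex.exp (((‖g‖ ^ 2 * z.re : ℝ) : ℂ) * Complex.I) ∂(μ.map (qf M)) ∂ν := by
    have hM := continuous_qf M
    conv_lhs => rw [← map_norm_smul_prod_eq hμ hμ1 hν]
    rw [integral_map (by fun_prop) (by fun_prop), integral_prod]
    · refine integral_congr_ae (.of_forall fun g => ?_)
      simp only
      rw [integral_map (by fun_prop) (by fun_prop)]
      simp only [qf_real_smul, ← Complex.ofReal_pow, Complex.re_ofReal_mul]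
    · exact Integrable.of_bound (by fun_prop) 1 (by simp [Complex.norm_exp_ofReal_mul_I])
  rw [key H, key K, h]

lemma Matrix.IsHermitian.map_qf_eq
    (hμ : ∀ U ∈ unitaryGroup ι ℂ, μ.map (fun u => toEuclideanLin U u) = μ)
    {H : Matrix ι ι ℂ} (hH : H.IsHermitian) :
    μ.map (qf H) = μ.map (qf (diagonal fun i => (hH.eigenvalues i : ℂ))) := by
  have hU : (hH.eigenvectorUnitary : Matrix ι ι ℂ) ∈ unitaryGroup ι ℂ := hH.eigenvectorUnitary.2
  have hs := hH.conjStarAlgAut_star_eigenvectorUnitary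
  rw [Unitary.conjStarAlgAut_star_apply] at hs
  conv_lhs => rw [← hμ _ hU]
  rw [Measure.map_map (continuous_qf H).measurable (continuous_toEuclideanLin _).measurable]
  congr 1
  funext u
  simp only [Function.comp_apply, qf_toEuclideanLin]
  congr 1

lemma map_qf_eq_of_charpoly_eq
    (hμ : ∀ U ∈ unitaryGroup ι ℂ, μ.map (fun u => toEuclideanLin U u) = μ)
    {H K : Matrix ι ι ℂ} (hH : H.IsHermitian) (hK : K.IsHermitian) (h : H.charpoly = K.charpoly) :
    μ.map (qf H) = μ.map (qf K) := by
  rw [hH.map_qf_eq hμ, hK.map_qf_eq hμ, (hH.eigenvalues_eq_eigenvalues_iff hK).2 h]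

omit [DecidableEq ι] in
/-- Cramér–Wold for numerical shadows. -/
lemma map_qf_eq_iff_forall_smul_add_conj_smul [IsFiniteMeasure μ] (A B : Matrix ι ι ℂ) :
    μ.map (qf A) = μ.map (qf B) ↔ ∀ z : ℂ,
      μ.map (qf (z • A + (starRingEnd ℂ) z • Aᴴ)) = μ.map (qf (z • B + (starRingEnd ℂ) z • Bᴴ)) := by
  constructor
  · intro h z
    have key (M : Matrix ι ι ℂ) : μ.map (qf (z • M + (starRingEnd ℂ) z • Mᴴ))
        = (μ.map (qf M)).map fun w => ((2 * (z * w).re : ℝ) : ℂ) := by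
      rw [Measure.map_map (by fun_prop) (continuous_qf M).measurable]
      congr 1
      exact funext fun u => qf_smul_add_conj_smul M z u
    rw [key, key, h]
  · intro h
    refine Measure.ext_of_charFun (funext fun w => ?_)
    have key (M : Matrix ι ι ℂ) : charFun (μ.map (qf M)) w
        = ∫ z, Complex.exp (((z.re / 2 : ℝ) : ℂ) * Complex.I)
          ∂(μ.map (qf ((starRingEnd ℂ) w • M + (starRingEnd ℂ) ((starRingEnd ℂ) w) • Mᴴ))) := by
      rw [charFun_apply, integral_map (continuous_qf M).aemeasurable (by fun_prop),
        integral_map (continuous_qf _).aemeasurable (by fun_prop)]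
      refine integral_congr_ae (.of_forall fun u => ?_)
      simp only [qf_smul_add_conj_smul, Complex.ofReal_re, Complex.inner]
      congr 3
      simp
    rw [key, key, h]

end CharFun

section Gaussian

/-- The measure on `ℂ` with density `exp (-‖z‖²)`. -/
noncomputable def gaussianComplex : Measure ℂ :=
  volume.withDensity fun z => ENNReal.ofReal (Real.exp (-‖z‖ ^ 2))

lemma integral_gaussianComplex (f : ℂ → ℂ) :
    ∫ z, f z ∂gaussianComplex = ∫ z : ℂ, Complex.exp (-1 * (‖z‖ : ℂ) ^ 2) * f z := by
  rw [gaussianComplex, integral_withDensity_eq_integral_toReal_smul (by fun_prop) (by simp)]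
  refine integral_congr_ae (.of_forall fun z => ?_)
  simp [ENNReal.toReal_ofReal, Real.exp_nonneg]

instance : IsFiniteMeasure gaussianComplex := by
  refine isFiniteMeasure_withDensity_ofReal (Integrable.hasFiniteIntegral ?_)
  have := (GaussianFourier.integrable_cexp_neg_mul_sq_norm_add (b := 1) (V := ℂ) (by simp) 0 0).re
  refine this.congr (.of_forall fun z => ?_)
  have : -1 * (‖z‖ : ℂ) ^ 2 + 0 * ((inner ℝ (0 : ℂ) z : ℝ) : ℂ) = ((-‖z‖ ^ 2 : ℝ) : ℂ) := by simp
  simp only [this, RCLike.re_to_complex, Complex.exp_ofReal_re]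

lemma charFun_gaussianComplex (x : ℂ) :
    charFun gaussianComplex x = Real.pi * Complex.exp (-(‖x‖ : ℂ) ^ 2 / 4) := by
  have := GaussianFourier.integral_cexp_neg_mul_sq_norm_add (b := 1) (by simp) Complex.I x
  simp only [Complex.finrank_real_complex, div_one, Nat.cast_ofNat, div_self (two_ne_zero' ℂ),
    Complex.cpow_one, Complex.I_sq, neg_one_mul, mul_one] at this
  rw [charFun_apply, integral_gaussianComplex, ← this]
  refine integral_congr_ae (.of_forall fun z => ?_)
  simp only [← Complex.exp_add, real_inner_comm, neg_one_mul]
  ring_nf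

lemma integral_cexp_sq_norm_gaussianComplex (a : ℝ) :
    ∫ z, Complex.exp (((a * ‖z‖ ^ 2 : ℝ) : ℂ) * Complex.I) ∂gaussianComplex
      = Real.pi / (1 - Complex.I * a) := by
  have := GaussianFourier.integral_cexp_neg_mul_sq_norm (V := ℂ) (b := 1 - Complex.I * a) (by simp)
  simp only [Complex.finrank_real_complex, Nat.cast_ofNat, div_self (two_ne_zero' ℂ),
    Complex.cpow_one] at this
  rw [integral_gaussianComplex, ← this]
  refine integral_congr_ae (.of_forall fun z => ?_)
  simp only [← Complex.exp_add]
  push_cast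
  ring_nf

variable (ι : Type*) [Fintype ι]

/-- The measure on `ℂ^ι` with density `exp (-‖g‖²)`. -/
noncomputable def gaussianEuclidean : Measure (EuclideanSpace ℂ ι) :=
  (Measure.pi fun _ : ι => gaussianComplex).map (MeasurableEquiv.toLp 2 (ι → ℂ))

instance : IsFiniteMeasure (gaussianEuclidean ι) := by
  unfold gaussianEuclidean
  infer_instance

variable {ι}

lemma integral_gaussianEuclidean (f : EuclideanSpace ℂ ι → ℂ) :
    ∫ g, f g ∂gaussianEuclidean ι
      = ∫ g : ι → ℂ, f (WithLp.toLp 2 g) ∂(Measure.pi fun _ : ι => gaussianComplex) :=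
  integral_map_equiv _ _

lemma charFun_gaussianEuclidean (x : EuclideanSpace ℂ ι) :
    charFun (gaussianEuclidean ι) x
      = (Real.pi : ℂ) ^ Fintype.card ι * Complex.exp (-(‖x‖ : ℂ) ^ 2 / 4) := by
  rw [charFun_apply, integral_gaussianEuclidean]
  simp only [PiLp.inner_apply, Complex.ofReal_sum, Finset.sum_mul, Complex.exp_sum]
  rw [integral_fintype_prod_eq_prod (fun i z => Complex.exp (inner ℝ z (x i) * Complex.I))]
  simp only [← charFun_apply, charFun_gaussianComplex, Finset.prod_mul_distrib, ← Complex.exp_sum,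
    Finset.prod_const, Finset.card_univ, ← Complex.ofReal_pow, EuclideanSpace.norm_sq_eq]
  simp [neg_div, Finset.sum_div]

variable [DecidableEq ι]

lemma map_toEuclideanLin_gaussianEuclidean (U : Matrix ι ι ℂ) (hU : U ∈ unitaryGroup ι ℂ) :
    (gaussianEuclidean ι).map (fun u => toEuclideanLin U u) = gaussianEuclidean ι :=
  map_toEuclideanLin_of_charFun_eq
    (fun x y h => by rw [charFun_gaussianEuclidean, charFun_gaussianEuclidean, h]) hU

lemma Matrix.IsHermitian.det_one_sub_smul {H : Matrix ι ι ℂ} (hH : H.IsHermitian) (a : ℂ) :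
    (1 - a • H).det = ∏ i, (1 - a * hH.eigenvalues i) := by
  have hs := hH.spectral_theorem
  rw [Unitary.conjStarAlgAut_apply] at hs
  set U : Matrix ι ι ℂ := hH.eigenvectorUnitary.1
  have hU : U * star U = 1 := mem_unitaryGroup_iff.1 hH.eigenvectorUnitary.2
  have h1 : 1 - a • H
      = U * diagonal (fun i => 1 - a * (hH.eigenvalues i : ℂ)) * star U := by
    have : (diagonal fun i => 1 - a * (hH.eigenvalues i : ℂ))
        = 1 - a • diagonal (RCLike.ofReal ∘ hH.eigenvalues) := by
      rw [← diagonal_one, ← diagonal_smul, diagonal_sub]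
      rfl
    conv_lhs => rw [hs]
    rw [this, mul_sub, sub_mul, mul_one, hU, Matrix.mul_smul, Matrix.smul_mul]
  rw [h1, det_mul_right_comm, hU, one_mul, det_diagonal]

lemma Matrix.IsHermitian.integral_cexp_qf_gaussianEuclidean {H : Matrix ι ι ℂ}
    (hH : H.IsHermitian) :
    ∫ g, Complex.exp ((qf H g).re * Complex.I) ∂gaussianEuclidean ι
      = (Real.pi : ℂ) ^ Fintype.card ι / (1 - Complex.I • H).det := by
  have hmap := hH.map_qf_eq map_toEuclideanLin_gaussianEuclidean
  have h_int (M : Matrix ι ι ℂ) : ∫ g, Complex.exp ((qf M g).re * Complex.I) ∂gaussianEuclidean ι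
      = ∫ z, Complex.exp (z.re * Complex.I) ∂(gaussianEuclidean ι).map (qf M) := by
    rw [integral_map (continuous_qf M).aemeasurable (by fun_prop)]
  rw [h_int, hmap, ← h_int, integral_gaussianEuclidean]
  simp only [qf_diagonal, ← Complex.ofReal_mul, ← Complex.ofReal_sum, Complex.ofReal_re]
  simp only [Complex.ofReal_sum, Finset.sum_mul, Complex.exp_sum]
  rw [integral_fintype_prod_eq_prod
    (fun i z => Complex.exp (((hH.eigenvalues i * ‖z‖ ^ 2 : ℝ) : ℂ) * Complex.I))]
  simp only [integral_cexp_sq_norm_gaussianComplex, Finset.prod_div_distrib, Finset.prod_const,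
    Finset.card_univ, hH.det_one_sub_smul]

end Gaussian

section Det

variable {ι : Type*} [Fintype ι] [DecidableEq ι]

lemma infinite_of_forall_ofReal {s : Set ℂ} (h : ∀ x : ℝ, (x : ℂ) ∈ s) : s.Infinite :=
  (Set.infinite_range_of_injective Complex.ofReal_injective).mono (Set.range_subset_iff.2 h)

lemma det_add_smul_eq_of_forall_real {M C M' C' : Matrix ι ι ℂ}
    (h : ∀ x : ℝ, (M + (x : ℂ) • C).det = (M' + (x : ℂ) • C').det) (z : ℂ) :
    (M + z • C).det = (M' + z • C').det := by
  let p (M C : Matrix ι ι ℂ) : Polynomial ℂ :=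
    (M.map Polynomial.C + (Polynomial.X : Polynomial ℂ) • C.map Polynomial.C).det
  have hp (M C : Matrix ι ι ℂ) (z : ℂ) : (p M C).eval z = (M + z • C).det := by
    rw [← Polynomial.coe_evalRingHom, RingHom.map_det]
    congr 1
    ext i j
    simpa using mul_comm _ _
  have : p M C = p M' C' := Polynomial.eq_of_infinite_eval_eq _ _
    (infinite_of_forall_ofReal fun x => by simpa only [Set.mem_ofPred_eq, hp] using h x)
  rw [← hp, ← hp, this]

lemma det_add_smul_add_smul_eq_of_forall_real {M C D M' C' D' : Matrix ι ι ℂ}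
    (h : ∀ x y : ℝ, (M + (x : ℂ) • C + (y : ℂ) • D).det = (M' + (x : ℂ) • C' + (y : ℂ) • D').det)
    (z w : ℂ) : (M + z • C + w • D).det = (M' + z • C' + w • D').det := by
  have h1 (x : ℝ) (w : ℂ) := det_add_smul_eq_of_forall_real (h x) w
  have h2 := det_add_smul_eq_of_forall_real (M := M + w • D) (C := C) (M' := M' + w • D') (C' := C')
    (fun x => by simpa only [add_right_comm] using h1 x w) z
  simpa only [add_right_comm] using h2

lemma charpoly_eq_of_forall_det_one_sub_smul_eq {H K : Matrix ι ι ℂ}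
    (h : ∀ x : ℂ, (1 - x • H).det = (1 - x • K).det) : H.charpoly = K.charpoly := by
  have key (M : Matrix ι ι ℂ) {x : ℂ} (hx : x ≠ 0) :
      M.charpoly.eval x = x ^ Fintype.card ι * (1 - x⁻¹ • M).det := by
    rw [eval_charpoly, ← det_smul, smul_sub, smul_inv_smul₀ hx, scalar_apply, smul_one_eq_diagonal]
  refine Polynomial.eq_of_infinite_eval_eq _ _
    ((Set.finite_singleton (0 : ℂ)).infinite_compl.mono ?_)
  intro x hx
  have hx : x ≠ 0 := hx
  rw [Set.mem_ofPred_eq, key H hx, key K hx, h]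

end Det

lemma det_eq_of_map_qf_eq {ι : Type*} [Fintype ι] [DecidableEq ι]
    {μ : Measure (EuclideanSpace ℂ ι)} [IsProbabilityMeasure μ]
    (hμ : ∀ U ∈ unitaryGroup ι ℂ, μ.map (fun u => toEuclideanLin U u) = μ)
    (hμ1 : ∀ᵐ u ∂μ, ‖u‖ = 1)
    {H K : Matrix ι ι ℂ} (hH : H.IsHermitian) (hK : K.IsHermitian)
    (h : μ.map (qf H) = μ.map (qf K)) : (1 - Complex.I • H).det = (1 - Complex.I • K).det := by
  have := integral_cexp_qf_eq_of_map_qf_eq hμ hμ1 map_toEuclideanLin_gaussianEuclidean h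
  rw [hH.integral_cexp_qf_gaussianEuclidean, hK.integral_cexp_qf_gaussianEuclidean] at this
  have hpi : (Real.pi : ℂ) ^ Fintype.card ι ≠ 0 := pow_ne_zero _ (by simp [Real.pi_ne_zero])
  simpa [div_eq_mul_inv, hpi] using this

lemma isHermitian_smul_add_conj_smul {ι : Type*} (A : Matrix ι ι ℂ) (z : ℂ) :
    (z • A + (starRingEnd ℂ) z • Aᴴ).IsHermitian := by
  simp [IsHermitian, add_comm]

/-- The numerical shadows of `A` and `B` coincide iff
`det(I − sA − tA*) = det(I − sB − tB*)` for all real `s, t`. -/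
theorem stmt_5 (N : ℕ) (hN : 1 ≤ N)
    (A B : Matrix (Fin N) (Fin N) ℂ)
    [MeasurableSpace (EuclideanSpace ℂ (Fin N))] [BorelSpace (EuclideanSpace ℂ (Fin N))]
    (μ : Measure (EuclideanSpace ℂ (Fin N))) (hμ : IsUniformOnSphere μ) :
    μ.map (qf A) = μ.map (qf B) ↔
      ∀ s t : ℝ,
        Matrix.det (1 - (s : ℂ) • A - (t : ℂ) • Aᴴ)
          = Matrix.det (1 - (s : ℂ) • B - (t : ℂ) • Bᴴ) := by
  rename_i mE bE
  obtain rfl : mE = WithLp.measurableSpace 2 (Fin N → ℂ) := by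
    rw [bE.measurable_eq]
    exact (@BorelSpace.measurable_eq _ _ (WithLp.measurableSpace 2 (Fin N → ℂ)) _).symm
  obtain ⟨hprob, hsphere, hμ⟩ := hμ
  have hμ1 : ∀ᵐ u ∂μ, ‖u‖ = 1 := by
    have := (prob_compl_eq_zero_iff Metric.isClosed_sphere.measurableSet).2 hsphere
    filter_upwards [measure_eq_zero_iff_ae_notMem.1 this] with u hu
    simpa using hu
  constructor
  · intro h
    rw [map_qf_eq_iff_forall_smul_add_conj_smul] at h
    have hz (z : ℂ) : (1 - (z • A + (starRingEnd ℂ) z • Aᴴ)).det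
        = (1 - (z • B + (starRingEnd ℂ) z • Bᴴ)).det := by
      have hr (x : ℝ) := det_eq_of_map_qf_eq hμ hμ1 (isHermitian_smul_add_conj_smul A (x * z))
        (isHermitian_smul_add_conj_smul B (x * z)) (h (x * z))
      have := det_add_smul_eq_of_forall_real (M := 1) (M' := 1)
        (C := -(Complex.I • (z • A + (starRingEnd ℂ) z • Aᴴ)))
        (C' := -(Complex.I • (z • B + (starRingEnd ℂ) z • Bᴴ)))
        (fun x => by
          convert! hr x using 2 <;>
          · simp only [map_mul, Complex.conj_ofReal]
            module) (-Complex.I)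
      have hI (M : Matrix (Fin N) (Fin N) ℂ) : 1 + -Complex.I • -(Complex.I • M) = 1 - M := by
        simp [smul_smul, sub_eq_add_neg]
      rwa [hI, hI] at this
    intro s t
    have := det_add_smul_add_smul_eq_of_forall_real (M := 1) (M' := 1)
      (C := -(A + Aᴴ)) (C' := -(B + Bᴴ))
      (D := -(Complex.I • A - Complex.I • Aᴴ)) (D' := -(Complex.I • B - Complex.I • Bᴴ))
      (fun x y => by
        convert! hz (x + y * Complex.I) using 2 <;>
        · simp only [map_add, map_mul, Complex.conj_ofReal, Complex.conj_I]
          module) ((s + t) / 2) (-Complex.I * ((s - t) / 2))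
    have hI (M : Matrix (Fin N) (Fin N) ℂ) : 1 - (s : ℂ) • M - (t : ℂ) • Mᴴ
        = 1 + (((s : ℂ) + t) / 2) • -(M + Mᴴ)
          + (-Complex.I * (((s : ℂ) - t) / 2)) • -(Complex.I • M - Complex.I • Mᴴ) := by
      match_scalars
      · ring
      · linear_combination ((t : ℂ) - s) / 2 * Complex.I_sq
      · linear_combination ((s : ℂ) - t) / 2 * Complex.I_sq
    rw [hI, hI, this]
  · intro h
    rw [map_qf_eq_iff_forall_smul_add_conj_smul]
    intro z
    refine map_qf_eq_of_charpoly_eq hμ (isHermitian_smul_add_conj_smul A z)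
      (isHermitian_smul_add_conj_smul B z) (charpoly_eq_of_forall_det_one_sub_smul_eq fun x => ?_)
    have := det_add_smul_add_smul_eq_of_forall_real (M := 1) (M' := 1)
      (C := -A) (C' := -B) (D := -Aᴴ) (D' := -Bᴴ)
      (fun s t => by simpa [← sub_eq_add_neg] using h s t) (x * z) (x * (starRingEnd ℂ) z)
    convert! this using 2 <;> module
end

section
/- Let β ≥ 0, δ > 0 and let k ≥ 1 be an integer. Define G on (0,1) by G(x) = (Γ(β+1)Γ(δ+k)/(Γ(β+δ)(k−1)!)) · (1−x)^{β+δ−1} · H(δ, β+1−k; β+δ; 1−x). Then for every m ∈ ℕ, ∫₀¹ x^m G(x) dx = (m! (k)_m) / ((β+1)_m (δ+k)_m); in particular (taking m = 0) G is a probability density on (0,1). -/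
open MeasureTheory

/-- The Gauss hypergeometric series `H(a,b;c;t) = ∑_j ((a)_j (b)_j / ((c)_j j!)) t^j`. -/
noncomputable def GaussH (a b c t : ℝ) : ℝ :=
  ∑' j : ℕ, ((ascPochhammer ℝ j).eval a * (ascPochhammer ℝ j).eval b /
      ((ascPochhammer ℝ j).eval c * (j.factorial : ℝ))) * t ^ j

/-- The function `F_N`, defined by
`F_N(x) = (Γ(N/2)Γ((N+1)/2)/Γ(N−3/2)) (1−x)^{N−5/2} H((N−1)/2,(N−2)/2;N−3/2;1−x)`
for `x < 1` and `F_N(x) = 0` for `x ≥ 1`. -/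
noncomputable def Fdens (N : ℕ) (x : ℝ) : ℝ :=
  if x < 1 then
    (Real.Gamma ((N : ℝ) / 2) * Real.Gamma (((N : ℝ) + 1) / 2) /
        Real.Gamma ((N : ℝ) - 3 / 2)) *
      (1 - x) ^ ((N : ℝ) - 5 / 2) *
      GaussH (((N : ℝ) - 1) / 2) (((N : ℝ) - 2) / 2) ((N : ℝ) - 3 / 2) (1 - x)
  else 0

open ProbabilityTheory in
/-- The real beta integral. -/
theorem integrableOn_and_integral_rpow_mul_one_sub_rpow {p q : ℝ} (hp : 0 < p) (hq : 0 < q) :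
    IntegrableOn (fun t : ℝ => t ^ (p - 1) * (1 - t) ^ (q - 1)) (Set.Ioo 0 1) ∧
      ∫ t in Set.Ioo (0 : ℝ) 1, t ^ (p - 1) * (1 - t) ^ (q - 1) = beta p q := by
  have hcast : Set.EqOn (fun t : ℝ => (t : ℂ) ^ ((p : ℂ) - 1) * (1 - (t : ℂ)) ^ ((q : ℂ) - 1))
      (fun t : ℝ => ((t ^ (p - 1) * (1 - t) ^ (q - 1) : ℝ) : ℂ)) (Set.Ioo 0 1) := by
    intro t ht
    have h1 : 0 ≤ t := ht.1.le
    have h2 : 0 ≤ 1 - t := by linarith [ht.2]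
    push_cast [Complex.ofReal_cpow h1, Complex.ofReal_cpow h2]
    rfl
  have hint := Complex.betaIntegral_convergent (u := p) (v := q) (by simpa) (by simpa)
  rw [intervalIntegrable_iff_integrableOn_Ioo_of_le zero_le_one] at hint
  refine ⟨by simpa [IntegrableOn] using (hint.congr_fun hcast measurableSet_Ioo).re, ?_⟩
  rw [beta_eq_betaIntegralReal p q hp hq, Complex.betaIntegral,
    intervalIntegral.integral_of_le zero_le_one, integral_Ioc_eq_integral_Ioo,
    setIntegral_congr_fun measurableSet_Ioo hcast, integral_complex_ofReal, Complex.ofReal_re]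

theorem Real.Gamma_add_natCast {x : ℝ} (hx : 0 < x) (n : ℕ) :
    Real.Gamma (x + n) = Real.Gamma x * (ascPochhammer ℝ n).eval x := by
  induction n with
  | zero => simp
  | succ n ih =>
    rw [ascPochhammer_succ_eval, Nat.cast_succ, ← add_assoc, Real.Gamma_add_one (by positivity), ih]
    ring

open ProbabilityTheory in
theorem beta_add_natCast {p q : ℝ} (hp : 0 < p) (hq : 0 < q) (n : ℕ) :
    beta (p + n) q =
      beta p q * ((ascPochhammer ℝ n).eval p / (ascPochhammer ℝ n).eval (p + q)) := by
  rw [beta, beta, add_right_comm, Real.Gamma_add_natCast hp,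
    Real.Gamma_add_natCast (add_pos hp hq), div_mul_div_comm]
  ring

open ProbabilityTheory in
/-- Termwise integration of a power series against a beta kernel. -/
theorem integral_rpow_mul_one_sub_rpow_mul_tsum {p q : ℝ} (hp : 0 < p) (hq : 0 < q) (w : ℕ → ℝ)
    (hw : Summable fun j =>
      |w j * ((ascPochhammer ℝ j).eval p / (ascPochhammer ℝ j).eval (p + q))|) :
    ∫ t in Set.Ioo (0 : ℝ) 1, t ^ (p - 1) * (1 - t) ^ (q - 1) * ∑' j, w j * t ^ j =
      beta p q *
        ∑' j, w j * ((ascPochhammer ℝ j).eval p / (ascPochhammer ℝ j).eval (p + q)) := by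
  have hpj (j : ℕ) : 0 < p + j := by positivity
  have hker (j : ℕ) := integrableOn_and_integral_rpow_mul_one_sub_rpow (hpj j) hq
  have hval (j : ℕ) (a : ℝ) :
      ∫ t in Set.Ioo (0 : ℝ) 1, a * (t ^ (p + j - 1) * (1 - t) ^ (q - 1)) =
        beta p q *
          (a * ((ascPochhammer ℝ j).eval p / (ascPochhammer ℝ j).eval (p + q))) := by
    rw [integral_const_mul, (hker j).2, beta_add_natCast hp hq]
    ring
  have hnorm (j : ℕ) :
      ∫ t in Set.Ioo (0 : ℝ) 1, ‖w j * (t ^ (p + j - 1) * (1 - t) ^ (q - 1))‖ =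
        beta p q *
          |w j * ((ascPochhammer ℝ j).eval p / (ascPochhammer ℝ j).eval (p + q))| := by
    rw [abs_mul, abs_of_pos (div_pos (ascPochhammer_pos j p hp)
      (ascPochhammer_pos j _ (add_pos hp hq))), ← hval]
    refine setIntegral_congr_fun measurableSet_Ioo fun t ht => ?_
    have h1 : 0 < t := ht.1
    have h2 : 0 < 1 - t := by linarith [ht.2]
    simp only [norm_mul, Real.norm_eq_abs, abs_of_pos (Real.rpow_pos_of_pos h1 _),
      abs_of_pos (Real.rpow_pos_of_pos h2 _)]
  have hsum := hasSum_integral_of_summable_integral_norm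
    (F := fun (j : ℕ) (t : ℝ) => w j * (t ^ (p + j - 1) * (1 - t) ^ (q - 1)))
    (fun j => (hker j).1.const_mul (w j)) (by simpa only [hnorm] using hw.mul_left (beta p q))
  simp only [hval] at hsum
  rw [← tsum_mul_left, hsum.tsum_eq]
  refine setIntegral_congr_fun measurableSet_Ioo fun t ht => ?_
  rw [← tsum_mul_left]
  refine tsum_congr fun j => ?_
  rw [add_sub_right_comm, Real.rpow_add ht.1, Real.rpow_natCast]
  ring

/-- A form of Raabe's test. -/
theorem summable_of_le_mul_sub {v : ℕ → ℝ} (hv : ∀ j, 0 ≤ v j) {K : ℝ} (hK : 0 ≤ K) {N : ℕ}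
    (h : ∀ j, N ≤ j → v j ≤ K * (j * v j - (j + 1) * v (j + 1))) : Summable v := by
  rw [← summable_nat_add_iff N]
  refine summable_of_sum_range_le (c := K * (N * v N)) (fun n => hv _) fun n => ?_
  have hpartial : ∑ i ∈ Finset.range n, v (i + N) ≤
      K * (N * v N - ((n + N : ℕ) : ℝ) * v (n + N)) := by
    induction n with
    | zero => simp
    | succ n ih =>
      rw [Finset.sum_range_succ]
      have := h (n + N) (by omega)
      rw [show n + 1 + N = n + N + 1 by omega]
      push_cast at *
      linarith
  refine hpartial.trans (mul_le_mul_of_nonneg_left ?_ hK)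
  have := hv (n + N)
  have : 0 ≤ ((n + N : ℕ) : ℝ) * v (n + N) := by positivity
  linarith

/-- Absolute convergence of the Gauss series at `1`. -/
theorem summable_abs_gauss_coeff {a b c : ℝ} (ha : 0 < a) (hc : 0 < c) (h : 0 < c - a - b) :
    Summable fun j : ℕ => |(ascPochhammer ℝ j).eval a * (ascPochhammer ℝ j).eval b /
      ((ascPochhammer ℝ j).eval c * (j.factorial : ℝ))| := by
  obtain ⟨N, hN⟩ := exists_nat_ge (max |b| (c + 2 * (a * b) / (c - a - b)))
  refine summable_of_le_mul_sub (fun j => abs_nonneg _) (K := 2 / (c - a - b)) (by positivity)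
    (N := N) fun j hj => ?_
  have hNj : (N : ℝ) ≤ j := by exact_mod_cast hj
  have hbj : 0 ≤ b + j := by
    linarith [neg_abs_le b, (le_max_left _ _).trans hN]
  have hj2 : c + 2 * (a * b) / (c - a - b) ≤ j := ((le_max_right _ _).trans hN).trans hNj
  have hcj : 0 < c + j := by positivity
  have haj : 0 < a + j := by positivity
  have hC := ascPochhammer_pos j c hc
  have hsucc : (ascPochhammer ℝ (j + 1)).eval a * (ascPochhammer ℝ (j + 1)).eval b /
      ((ascPochhammer ℝ (j + 1)).eval c * ((j + 1).factorial : ℝ)) =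
      (ascPochhammer ℝ j).eval a * (ascPochhammer ℝ j).eval b /
      ((ascPochhammer ℝ j).eval c * (j.factorial : ℝ)) *
        ((a + j) * (b + j) / ((c + j) * (j + 1))) := by
    simp only [ascPochhammer_succ_eval, Nat.factorial_succ]
    push_cast
    field_simp
  rw [hsucc, abs_mul, abs_of_nonneg (a := (a + j) * (b + j) / ((c + j) * (j + 1)))
    (by positivity)]
  set v := |(ascPochhammer ℝ j).eval a * (ascPochhammer ℝ j).eval b /
      ((ascPochhammer ℝ j).eval c * (j.factorial : ℝ))|
  have hv : 0 ≤ v := abs_nonneg _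
  have hfac : 2 / (c - a - b) * (j * v - (j + 1) * (v * ((a + j) * (b + j) / ((c + j) * (j + 1)))))
      = v * ((2 * j - 2 * (a * b) / (c - a - b)) / (c + j)) := by
    field_simp
    ring
  rw [hfac]
  refine le_mul_of_one_le_right hv ?_
  rw [one_le_div hcj]
  linarith

/-- The binomial series in Pochhammer form. -/
theorem tsum_ascPochhammer_mul_pow {b t : ℝ} (ht : t ∈ Set.Ioo (0 : ℝ) 1) :
    ∑' j : ℕ, (ascPochhammer ℝ j).eval b / (j.factorial : ℝ) * t ^ j = (1 - t) ^ (-b) := by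
  have hmem : t ∈ Metric.eball (0 : ℝ) 1 := by
    rw [← ENNReal.ofReal_one, Metric.eball_ofReal]
    simpa [abs_of_pos ht.1] using ht.2
  have hs := (Real.one_div_one_sub_rpow_hasFPowerSeriesOnBall_zero b).hasSum hmem
  have hpos : 0 ≤ 1 - t := by linarith [ht.2]
  rw [Real.rpow_neg hpos, ← one_div]
  rw [zero_add] at hs
  rw [← hs.tsum_eq]
  refine tsum_congr fun j => ?_
  have hfac := Ring.factorial_nsmul_multichoose_eq_ascPochhammer b j
  rw [Polynomial.ascPochhammer_smeval_eq_eval, Ring.multichoose_eq, nsmul_eq_mul] at hfac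
  rw [← hfac]
  have : (j.factorial : ℝ) ≠ 0 := by positivity
  simp [FormalMultilinearSeries.ofScalars, mul_div_cancel_left₀ _ this]

/-- Gauss's summation theorem, for `0 < a < c` and `0 < c - a - b`. -/
theorem gauss_summation {a b c : ℝ} (ha : 0 < a) (hac : a < c) (h : 0 < c - a - b) :
    ∑' j : ℕ, (ascPochhammer ℝ j).eval a * (ascPochhammer ℝ j).eval b /
      ((ascPochhammer ℝ j).eval c * (j.factorial : ℝ)) =
      Real.Gamma c * Real.Gamma (c - a - b) / (Real.Gamma (c - a) * Real.Gamma (c - b)) := by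
  have hca : 0 < c - a := sub_pos.2 hac
  have hc : 0 < c := ha.trans hac
  have hterm (j : ℕ) : (ascPochhammer ℝ j).eval a * (ascPochhammer ℝ j).eval b /
      ((ascPochhammer ℝ j).eval c * (j.factorial : ℝ)) =
      (ascPochhammer ℝ j).eval b / (j.factorial : ℝ) *
        ((ascPochhammer ℝ j).eval a / (ascPochhammer ℝ j).eval (a + (c - a))) := by
    rw [add_sub_cancel, div_mul_div_comm]
    ring
  have hs := summable_abs_gauss_coeff ha hc h
  simp only [hterm] at hs ⊢
  have hint := integral_rpow_mul_one_sub_rpow_mul_tsum ha hca _ hs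
  have hker := (integrableOn_and_integral_rpow_mul_one_sub_rpow ha h).2
  have hcongr : ∫ t in Set.Ioo (0 : ℝ) 1, t ^ (a - 1) * (1 - t) ^ (c - a - 1) *
      ∑' j : ℕ, (ascPochhammer ℝ j).eval b / (j.factorial : ℝ) * t ^ j =
      ∫ t in Set.Ioo (0 : ℝ) 1, t ^ (a - 1) * (1 - t) ^ (c - a - b - 1) := by
    refine setIntegral_congr_fun measurableSet_Ioo fun t ht => ?_
    rw [tsum_ascPochhammer_mul_pow ht, mul_assoc, ← Real.rpow_add (by linarith [ht.2])]
    congr 2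
    ring
  rw [hcongr, hker] at hint
  generalize (∑' j : ℕ, (ascPochhammer ℝ j).eval b / (j.factorial : ℝ) *
        ((ascPochhammer ℝ j).eval a / (ascPochhammer ℝ j).eval (a + (c - a)))) = S at hint ⊢
  simp only [ProbabilityTheory.beta] at hint
  rw [add_sub_cancel, show a + (c - a - b) = c - b by ring] at hint
  have h1 := Real.Gamma_pos_of_pos ha
  have h2 := Real.Gamma_pos_of_pos hc
  have h3 := Real.Gamma_pos_of_pos hca
  have h4 : 0 < Real.Gamma (c - b) := Real.Gamma_pos_of_pos (by linarith)
  field_simp at hint ⊢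
  linarith

/-- Moments of a Gauss series weighted by a power. -/
theorem integral_pow_mul_one_sub_rpow_mul_GaussH {a b c : ℝ} (ha : 0 < a) (hc : 0 < c) (m : ℕ)
    (hac : a < c + (m + 1)) (h : 0 < c + (m + 1) - a - b) :
    ∫ x in Set.Ioo (0 : ℝ) 1, x ^ m * ((1 - x) ^ (c - 1) * GaussH a b c (1 - x)) =
      m.factorial * Real.Gamma c * Real.Gamma (c + (m + 1) - a - b) /
        (Real.Gamma (c + (m + 1) - a) * Real.Gamma (c + (m + 1) - b)) := by
  have hm : (0 : ℝ) < m + 1 := by positivity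
  have hcm : 0 < c + (m + 1) := by positivity
  have hterm (j : ℕ) : (ascPochhammer ℝ j).eval a * (ascPochhammer ℝ j).eval b /
      ((ascPochhammer ℝ j).eval (c + (m + 1)) * (j.factorial : ℝ)) =
      ((ascPochhammer ℝ j).eval a * (ascPochhammer ℝ j).eval b /
        ((ascPochhammer ℝ j).eval c * (j.factorial : ℝ))) *
        ((ascPochhammer ℝ j).eval c / (ascPochhammer ℝ j).eval (c + (m + 1))) := by
    have := ascPochhammer_pos j c hc
    have := ascPochhammer_pos j _ hcm
    field_simp
  have hs := summable_abs_gauss_coeff ha hcm h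
  have hgauss := gauss_summation ha hac h
  simp only [hterm] at hs hgauss
  have hint := integral_rpow_mul_one_sub_rpow_mul_tsum hc hm _ hs
  have hsub : ∫ x in Set.Ioo (0 : ℝ) 1, x ^ m * ((1 - x) ^ (c - 1) * GaussH a b c (1 - x)) =
      ∫ t in Set.Ioo (0 : ℝ) 1, t ^ (c - 1) * (1 - t) ^ ((m : ℝ) + 1 - 1) * GaussH a b c t := by
    have hrefl := intervalIntegral.integral_comp_sub_left (a := 0) (b := 1)
      (fun t : ℝ => t ^ (c - 1) * (1 - t) ^ ((m : ℝ) + 1 - 1) * GaussH a b c t) 1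
    rw [sub_self, sub_zero, intervalIntegral.integral_of_le zero_le_one,
      intervalIntegral.integral_of_le zero_le_one, integral_Ioc_eq_integral_Ioo,
      integral_Ioc_eq_integral_Ioo] at hrefl
    rw [← hrefl]
    refine integral_congr_ae (.of_forall fun x => ?_)
    simp only [sub_sub_cancel, add_sub_cancel_right, Real.rpow_natCast]
    ring
  rw [hsub]
  simp only [GaussH]
  rw [hint, hgauss, ProbabilityTheory.beta, Real.Gamma_nat_eq_factorial]
  have := Real.Gamma_pos_of_pos hcm
  field_simp

/-- Moments of the density
`G(x) = (Γ(β+1)Γ(δ+k)/(Γ(β+δ)(k−1)!)) (1−x)^{β+δ−1} H(δ, β+1−k; β+δ; 1−x)`: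
`∫₀¹ x^m G(x) dx = m!(k)_m / ((β+1)_m (δ+k)_m)`. -/
theorem stmt_9 (β δ : ℝ) (hβ : 0 ≤ β) (hδ : 0 < δ) (k : ℕ) (hk : 1 ≤ k)
    (G : ℝ → ℝ)
    (hG : ∀ x ∈ Set.Ioo (0 : ℝ) 1, G x =
      (Real.Gamma (β + 1) * Real.Gamma (δ + k) /
          (Real.Gamma (β + δ) * ((k - 1).factorial : ℝ))) *
        (1 - x) ^ (β + δ - 1) * GaussH δ (β + 1 - k) (β + δ) (1 - x))
    (m : ℕ) :
    ∫ x in Set.Ioo (0 : ℝ) 1, x ^ m * G x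
      = ((m.factorial : ℝ) * (ascPochhammer ℝ m).eval (k : ℝ)) /
          ((ascPochhammer ℝ m).eval (β + 1) * (ascPochhammer ℝ m).eval (δ + k)) := by
  have hk' : (1 : ℝ) ≤ k := by exact_mod_cast hk
  have hm : (0 : ℝ) ≤ m := m.cast_nonneg
  have hkm : (0 : ℝ) < k := by linarith
  have hβ1 : 0 < β + 1 := by linarith
  have hδk : 0 < δ + k := by linarith
  have hcongr : ∫ x in Set.Ioo (0 : ℝ) 1, x ^ m * G x =
      ∫ x in Set.Ioo (0 : ℝ) 1, (Real.Gamma (β + 1) * Real.Gamma (δ + k) /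
          (Real.Gamma (β + δ) * ((k - 1).factorial : ℝ))) *
        (x ^ m * ((1 - x) ^ (β + δ - 1) * GaussH δ (β + 1 - k) (β + δ) (1 - x))) := by
    refine setIntegral_congr_fun measurableSet_Ioo fun x hx => ?_
    rw [hG x hx]
    ring
  rw [hcongr, integral_const_mul, integral_pow_mul_one_sub_rpow_mul_GaussH hδ (by linarith) m
    (by linarith) (by linarith),
    show β + δ + (m + 1) - δ - (β + 1 - k) = k + m by ring,
    show β + δ + (m + 1) - δ = β + 1 + m by ring,
    show β + δ + (m + 1) - (β + 1 - k) = δ + k + m by ring,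
    Real.Gamma_add_natCast hkm, Real.Gamma_add_natCast hβ1, Real.Gamma_add_natCast hδk,
    show Real.Gamma k = ((k - 1).factorial : ℝ) by
      rw [← Real.Gamma_nat_eq_factorial]; push_cast [hk]; ring_nf]
  have h1 := Real.Gamma_pos_of_pos hβ1
  have h2 := Real.Gamma_pos_of_pos hδk
  have h3 : 0 < Real.Gamma (β + δ) := Real.Gamma_pos_of_pos (by linarith)
  have h4 := ascPochhammer_pos m _ hβ1
  have h5 := ascPochhammer_pos m _ hδk
  field_simp
end
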